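/- Let u_p be a least energy solution of the Finsler Lane-Emden problem -Q_N u = u^p in Ω, u > 0 in Ω, u = 0 on ∂Ω. Then lim_{p→∞} p^{N-1} ∫_Ω H(∇u_p)^N dx = lim_{p→∞} p^{N-1} ∫_Ω u_p^{p+1} dx = ((Ne/(N-1)) β_N)^{N-1}. -/

import Mathlib

open MeasureTheory Filter Real Set
open scoped RealInnerProductSpace Topology NNReal

noncomputable section

abbrev Euc (N : ℕ) := EuclideanSpace ℝ (Fin N)

/-- `H` is a norm on `ℝ^N`: convex, nonnegative, vanishing exactly at `0`,
and absolutely homogeneous. -/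
def IsFinslerNorm (N : ℕ) (H : Euc N → ℝ) : Prop :=
  ConvexOn ℝ Set.univ H ∧
  (∀ ξ, 0 ≤ H ξ) ∧
  (∀ ξ, H ξ = 0 ↔ ξ = 0) ∧
  (∀ (t : ℝ) (ξ : Euc N), H (t • ξ) = |t| * H ξ)

/-- Regularity assumptions: `H ∈ C²(ℝ^N \ {0})`, `H^N ∈ C¹(ℝ^N)`, and the Hessian of
`H^N` is positive definite away from the origin. -/
def FinslerRegular (N : ℕ) (H : Euc N → ℝ) : Prop :=
  ContDiffOn ℝ 2 H {(0 : Euc N)}ᶜ ∧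
  ContDiff ℝ 1 (fun ξ => H ξ ^ N) ∧
  ∀ ξ : Euc N, ξ ≠ 0 → ∀ v : Euc N, v ≠ 0 →
    0 < iteratedFDeriv ℝ 2 (fun ξ => H ξ ^ N) ξ ![v, v]

/-- The dual norm `H⁰(x) = sup_{ξ ≠ 0} ⟪x, ξ⟫ / H(ξ)`. -/
def dualNorm {N : ℕ} (H : Euc N → ℝ) (x : Euc N) : ℝ :=
  sSup {r : ℝ | ∃ ξ : Euc N, ξ ≠ 0 ∧ r = ⟪x, ξ⟫ / H ξ}

/-- `κ_N`, the volume of the Wulff ball `{H⁰ < 1}`. -/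
def wulffVol (N : ℕ) (H : Euc N → ℝ) : ℝ :=
  (volume {x : Euc N | dualNorm H x < 1}).toReal

/-- `β_N = N (N κ_N)^{1/(N-1)}`. -/
def betaN (N : ℕ) (H : Euc N → ℝ) : ℝ :=
  N * (N * wulffVol N H) ^ ((1 : ℝ) / ((N : ℝ) - 1))

/-- `u` is a weak solution of `-Q_N u = g` on the open set `U`:
`∫_U H(∇u)^{N-1} ⟪∇H(∇u), ∇φ⟫ = ∫_U g φ` for all test functions `φ`. -/
def IsWeakSolution (N : ℕ) (H : Euc N → ℝ) (U : Set (Euc N)) (u g : Euc N → ℝ) : Prop :=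
  ∀ φ : Euc N → ℝ, ContDiff ℝ (⊤ : ℕ∞) φ → HasCompactSupport φ → tsupport φ ⊆ U →
    (∫ x in U, H (gradient u x) ^ (N - 1) * ⟪gradient H (gradient u x), gradient φ x⟫)
      = ∫ x in U, g x * φ x

/-- `C_p`, the infimum of `∫_Ω H(∇u)^N` over test functions normalized in `L^{p+1}`. -/
def energyInf (N : ℕ) (H : Euc N → ℝ) (Ω : Set (Euc N)) (p : ℝ) : ℝ :=
  sInf {c : ℝ | ∃ u : Euc N → ℝ, ContDiff ℝ (⊤ : ℕ∞) u ∧ HasCompactSupport u ∧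
    tsupport u ⊆ Ω ∧ (∫ x in Ω, |u x| ^ (p + 1)) = 1 ∧
    c = ∫ x in Ω, H (gradient u x) ^ N}

/-- A least energy solution of the Finsler Lane–Emden problem on `Ω` with exponent `p`. -/
def IsLeastEnergySolution (N : ℕ) (H : Euc N → ℝ) (Ω : Set (Euc N)) (p : ℝ)
    (u : Euc N → ℝ) : Prop :=
  ContDiffOn ℝ 1 u (closure Ω) ∧
  (∀ x ∈ Ω, 0 < u x) ∧
  (∀ x ∈ frontier Ω, u x = 0) ∧
  IsWeakSolution N H Ω u (fun x => u x ^ p) ∧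
  (∫ x in Ω, H (gradient u x) ^ N)
    = energyInf N H Ω p * (∫ x in Ω, u x ^ (p + 1)) ^ ((N : ℝ) / (p + 1))

/-- The blow-up set of a sequence of functions `v n` on `Ω`. -/
def BlowUpSet {N : ℕ} (Ω : Set (Euc N)) (v : ℕ → Euc N → ℝ) : Set (Euc N) :=
  {x | x ∈ closure Ω ∧ ∃ σ : ℕ → ℕ, StrictMono σ ∧ ∃ xs : ℕ → Euc N,
    (∀ n, xs n ∈ Ω) ∧ Tendsto xs atTop (𝓝 x) ∧
    Tendsto (fun n => v (σ n) (xs n)) atTop atTop}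

/-! ### Finsler norms -/

namespace IsFinslerNorm

variable {N : ℕ} {H : Euc N → ℝ}

lemma nonneg (h : IsFinslerNorm N H) (x : Euc N) : 0 ≤ H x := h.2.1 x

lemma map_zero (h : IsFinslerNorm N H) : H 0 = 0 := (h.2.2.1 0).2 rfl

lemma pos (h : IsFinslerNorm N H) {x : Euc N} (hx : x ≠ 0) : 0 < H x :=
  lt_of_le_of_ne (h.nonneg x) fun h0 => hx ((h.2.2.1 x).1 h0.symm)

lemma map_smul (h : IsFinslerNorm N H) (t : ℝ) (x : Euc N) : H (t • x) = |t| * H x := h.2.2.2 t x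

lemma map_smul_of_nonneg (h : IsFinslerNorm N H) {t : ℝ} (ht : 0 ≤ t) (x : Euc N) :
    H (t • x) = t * H x := by rw [h.map_smul, abs_of_nonneg ht]

lemma map_neg (h : IsFinslerNorm N H) (x : Euc N) : H (-x) = H x := by
  simpa using h.map_smul (-1) x

lemma add_le (h : IsFinslerNorm N H) (x y : Euc N) : H (x + y) ≤ H x + H y := by
  have h1 := h.1.2 (mem_univ ((2 : ℝ) • x)) (mem_univ ((2 : ℝ) • y))
    (show (0 : ℝ) ≤ 1 / 2 by norm_num) (show (0 : ℝ) ≤ 1 / 2 by norm_num) (by norm_num)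
  rw [smul_smul, smul_smul, h.map_smul, h.map_smul] at h1
  norm_num at h1
  linarith

lemma sub_le (h : IsFinslerNorm N H) (x y : Euc N) : H x - H y ≤ H (x - y) := by
  have := h.add_le (x - y) y
  rw [sub_add_cancel] at this
  linarith

lemma abs_sub_le (h : IsFinslerNorm N H) (x y : Euc N) : |H x - H y| ≤ H (x - y) := by
  refine _root_.abs_sub_le_iff.2 ⟨h.sub_le x y, ?_⟩
  have := h.sub_le y x
  rwa [← h.map_neg (y - x), neg_sub] at this

lemma continuous (h : IsFinslerNorm N H) : Continuous H :=
  continuousOn_univ.1 (h.1.continuousOn isOpen_univ)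

lemma exists_le_norm (h : IsFinslerNorm N H) : ∃ C : ℝ, 0 < C ∧ ∀ x, H x ≤ C * ‖x‖ := by
  obtain ⟨C, hC⟩ := (isCompact_sphere (0 : Euc N) 1).bddAbove_image h.continuous.continuousOn
  refine ⟨max C 1, by positivity, fun x => ?_⟩
  rcases eq_or_ne x 0 with rfl | hx
  · simp [h.map_zero]
  have hx' : 0 < ‖x‖ := norm_pos_iff.2 hx
  have h1 : H (‖x‖⁻¹ • x) ≤ C := hC (mem_image_of_mem _ (by simp [norm_smul, hx'.ne']))
  rw [h.map_smul_of_nonneg (by positivity), inv_mul_le_iff₀ hx'] at h1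
  nlinarith [le_max_left C 1]

lemma exists_norm_le (h : IsFinslerNorm N H) : ∃ C : ℝ, 0 < C ∧ ∀ x, ‖x‖ ≤ C * H x := by
  rcases subsingleton_or_nontrivial (Euc N) with hs | hs
  · exact ⟨1, one_pos, fun x => by simp [Subsingleton.elim x 0, h.map_zero]⟩
  obtain ⟨z, hz, hmin⟩ := (isCompact_sphere (0 : Euc N) 1).exists_isMinOn
    (NormedSpace.sphere_nonempty.2 zero_le_one) h.continuous.continuousOn
  have hz0 : z ≠ 0 := by rintro rfl; simp at hz
  refine ⟨(H z)⁻¹, inv_pos.2 (h.pos hz0), fun x => ?_⟩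
  rcases eq_or_ne x 0 with rfl | hx
  · simp [h.map_zero]
  have hx' : 0 < ‖x‖ := norm_pos_iff.2 hx
  have h1 : H z ≤ H (‖x‖⁻¹ • x) := hmin (by simp [norm_smul, hx'.ne'])
  rw [h.map_smul_of_nonneg (by positivity), ← div_eq_inv_mul, le_div_iff₀ hx'] at h1
  rwa [← div_eq_inv_mul, le_div_iff₀ (h.pos hz0), mul_comm]

lemma isBounded_ball (h : IsFinslerNorm N H) (r : ℝ) :
    Bornology.IsBounded {x | H x < r} := by
  obtain ⟨C, hC, hb⟩ := h.exists_norm_le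
  refine (Metric.isBounded_closedBall (x := (0 : Euc N)) (r := C * r)).subset fun x hx => ?_
  simpa using (hb x).trans (mul_le_mul_of_nonneg_left (le_of_lt hx) hC.le)

lemma isOpen_ball (h : IsFinslerNorm N H) (r : ℝ) : IsOpen {x | H x < r} :=
  isOpen_lt h.continuous continuous_const

lemma bddAbove_dual (h : IsFinslerNorm N H) (x : Euc N) :
    BddAbove {r : ℝ | ∃ ξ : Euc N, ξ ≠ 0 ∧ r = ⟪x, ξ⟫ / H ξ} := by
  obtain ⟨C, hC, hb⟩ := h.exists_norm_le
  refine ⟨‖x‖ * C, ?_⟩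
  rintro r ⟨ξ, hξ, rfl⟩
  rw [div_le_iff₀ (h.pos hξ), mul_assoc]
  exact (real_inner_le_norm _ _).trans (mul_le_mul_of_nonneg_left (hb ξ) (norm_nonneg _))

lemma inner_le (h : IsFinslerNorm N H) (x ξ : Euc N) : ⟪x, ξ⟫ ≤ dualNorm H x * H ξ := by
  rcases eq_or_ne ξ 0 with rfl | hξ
  · simp [h.map_zero]
  rw [← div_le_iff₀ (h.pos hξ)]
  exact le_csSup (h.bddAbove_dual x) ⟨ξ, hξ, rfl⟩

lemma abs_inner_le (h : IsFinslerNorm N H) (x ξ : Euc N) : |⟪x, ξ⟫| ≤ dualNorm H x * H ξ := by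
  refine abs_le'.2 ⟨h.inner_le x ξ, ?_⟩
  have := h.inner_le x (-ξ)
  rwa [inner_neg_right, h.map_neg] at this

lemma dualNorm_le [Nontrivial (Euc N)] (h : IsFinslerNorm N H) {x : Euc N} {c : ℝ}
    (hc : ∀ ξ, ⟪x, ξ⟫ ≤ c * H ξ) : dualNorm H x ≤ c := by
  obtain ⟨z, hz⟩ := exists_ne (0 : Euc N)
  refine csSup_le ⟨_, z, hz, rfl⟩ ?_
  rintro r ⟨ξ, hξ, rfl⟩
  rw [div_le_iff₀ (h.pos hξ)]
  exact hc ξ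

lemma dualNorm_nonneg [Nontrivial (Euc N)] (h : IsFinslerNorm N H) (x : Euc N) :
    0 ≤ dualNorm H x := by
  obtain ⟨z, hz⟩ := exists_ne (0 : Euc N)
  exact nonneg_of_mul_nonneg_left ((abs_nonneg _).trans (h.abs_inner_le x z)) (h.pos hz)

lemma dualNorm_smul_le [Nontrivial (Euc N)] (h : IsFinslerNorm N H) (t : ℝ) (x : Euc N) :
    dualNorm H (t • x) ≤ |t| * dualNorm H x := by
  refine h.dualNorm_le fun ξ => ?_
  rw [inner_smul_left, mul_assoc]
  refine (le_abs_self _).trans ?_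
  rw [abs_mul]
  exact mul_le_mul (by simp) (h.abs_inner_le x ξ) (abs_nonneg _) (abs_nonneg _)

/-- The dual of a Finsler norm is a Finsler norm. -/
lemma dual [Nontrivial (Euc N)] (h : IsFinslerNorm N H) : IsFinslerNorm N (dualNorm H) := by
  have hsmul : ∀ (t : ℝ) (x : Euc N), dualNorm H (t • x) = |t| * dualNorm H x := by
    intro t x
    rcases eq_or_ne t 0 with rfl | ht
    · refine le_antisymm (h.dualNorm_smul_le 0 x) ?_
      simpa using h.dualNorm_nonneg (0 : Euc N)
    refine le_antisymm (h.dualNorm_smul_le t x) ?_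
    have := h.dualNorm_smul_le t⁻¹ (t • x)
    rwa [inv_smul_smul₀ ht, abs_inv, ← div_eq_inv_mul, le_div_iff₀ (abs_pos.2 ht), mul_comm] at this
  refine ⟨⟨convex_univ, fun x _ y _ a b ha hb _ => ?_⟩,
    h.dualNorm_nonneg, fun x => ⟨fun hx => ?_, ?_⟩,
    hsmul⟩
  · refine h.dualNorm_le fun ξ => ?_
    rw [inner_add_left, inner_smul_left, inner_smul_left, smul_eq_mul, smul_eq_mul, add_mul,
      mul_assoc, mul_assoc]
    exact add_le_add (mul_le_mul_of_nonneg_left (h.inner_le x ξ) ha)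
      (mul_le_mul_of_nonneg_left (h.inner_le y ξ) hb)
  · have := h.inner_le x x
    rw [hx, zero_mul] at this
    exact real_inner_self_nonpos.1 this
  · rintro rfl
    simpa using hsmul 0 0

lemma differentiableAt (_h : IsFinslerNorm N H) (hr : FinslerRegular N H) {ξ : Euc N}
    (hξ : ξ ≠ 0) : DifferentiableAt ℝ H ξ :=
  (hr.1.differentiableOn (by norm_num)).differentiableAt (isOpen_compl_singleton.mem_nhds hξ)

/-- Euler's identity for the `1`-homogeneous function `H`. -/
lemma inner_gradient_self (h : IsFinslerNorm N H) (hr : FinslerRegular N H) {ξ : Euc N}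
    (hξ : ξ ≠ 0) : ⟪gradient H ξ, ξ⟫ = H ξ := by
  have h1 : HasDerivAt (fun t : ℝ => H (ξ + t • ξ)) ⟪gradient H ξ, ξ⟫ 0 := by
    have h2 : HasFDerivAt H (fderiv ℝ H ξ) (ξ + (0 : ℝ) • ξ) := by
      simpa using (h.differentiableAt hr hξ).hasFDerivAt
    have h3 : HasDerivAt (fun t : ℝ => ξ + t • ξ) ξ 0 := by
      simpa using ((hasDerivAt_id (0 : ℝ)).smul_const ξ).const_add ξ
    rw [inner_gradient_left]
    exact h2.comp_hasDerivAt _ h3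
  have h2 : HasDerivAt (fun t : ℝ => H (ξ + t • ξ)) (H ξ) 0 := by
    have h3 : HasDerivAt (fun t : ℝ => (1 + t) * H ξ) (H ξ) 0 := by
      simpa using ((hasDerivAt_id (0 : ℝ)).const_add 1).mul_const (H ξ)
    refine h3.congr_of_eventuallyEq ?_
    filter_upwards [eventually_gt_nhds (show (-1 : ℝ) < 0 by norm_num)] with t ht
    rw [show ξ + t • ξ = (1 + t) • ξ by module, h.map_smul_of_nonneg (by linarith)]
  exact h1.unique h2

lemma inner_gradient_le (h : IsFinslerNorm N H) (hr : FinslerRegular N H) {ξ : Euc N}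
    (hξ : ξ ≠ 0) (η : Euc N) : ⟪gradient H ξ, η⟫ ≤ H η := by
  have h1 : HasDerivAt (fun t : ℝ => H (ξ + t • η)) ⟪gradient H ξ, η⟫ 0 := by
    have h2 : HasFDerivAt H (fderiv ℝ H ξ) (ξ + (0 : ℝ) • η) := by
      simpa using (h.differentiableAt hr hξ).hasFDerivAt
    have h3 : HasDerivAt (fun t : ℝ => ξ + t • η) η 0 := by
      simpa using ((hasDerivAt_id (0 : ℝ)).smul_const η).const_add ξ
    rw [inner_gradient_left]
    exact h2.comp_hasDerivAt _ h3
  refine le_of_tendsto h1.tendsto_slope_zero_right ?_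
  filter_upwards [self_mem_nhdsWithin] with t ht
  have ht : 0 < t := ht
  rw [smul_eq_mul, inv_mul_le_iff₀ ht]
  simp only [zero_add, zero_smul, add_zero]
  have := h.add_le ξ (t • η)
  rw [h.map_smul_of_nonneg ht.le] at this
  linarith

/-- `H` is dominated by any constant bounding all directional slopes with respect to the dual
norm. -/
lemma le_of_forall_inner_le [Nontrivial (Euc N)] (h : IsFinslerNorm N H) (hr : FinslerRegular N H)
    {ξ : Euc N} {c : ℝ} (hc0 : 0 ≤ c) (hc : ∀ v, ⟪ξ, v⟫ ≤ c * dualNorm H v) : H ξ ≤ c := by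
  rcases eq_or_ne ξ 0 with rfl | hξ
  · rwa [h.map_zero]
  rw [← h.inner_gradient_self hr hξ, real_inner_comm]
  refine (hc _).trans (mul_le_of_le_one_right hc0 (h.dualNorm_le fun η => ?_))
  simpa using h.inner_gradient_le hr hξ η

end IsFinslerNorm

lemma nontrivial_euc {N : ℕ} (hN : 2 ≤ N) : Nontrivial (Euc N) := by
  have : Nonempty (Fin N) := ⟨⟨0, by omega⟩⟩
  infer_instance

/-! ### Radial integrals for Finsler norms -/

/-- The volume of the unit ball of `F`. -/
def unitVol {N : ℕ} (F : Euc N → ℝ) : ℝ := (volume {x : Euc N | F x < 1}).toReal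

namespace IsFinslerNorm

variable {N : ℕ} {F : Euc N → ℝ}

lemma volume_ball_lt_top (h : IsFinslerNorm N F) (r : ℝ) : volume {x | F x < r} < ⊤ :=
  (h.isBounded_ball r).measure_lt_top

lemma unitVol_pos (h : IsFinslerNorm N F) : 0 < unitVol F :=
  ENNReal.toReal_pos ((h.isOpen_ball 1).measure_pos volume ⟨0, by simp [h.map_zero]⟩).ne'
    (h.volume_ball_lt_top 1).ne

open scoped Pointwise in
lemma volume_ball [Nontrivial (Euc N)] (h : IsFinslerNorm N F) (r : ℝ) (hr : 0 ≤ r) :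
    volume {x | F x < r} = ENNReal.ofReal (unitVol F * r ^ N) := by
  rcases hr.eq_or_lt with rfl | hr
  · have h0 : {x | F x < 0} = ∅ := by
      ext x; simpa using h.nonneg x
    have hN : N ≠ 0 := by
      rintro rfl
      exact not_subsingleton (Euc 0) inferInstance
    simp [h0, hN]
  have h1 : {x | F x < r} = r • {x | F x < 1} := by
    ext x
    rw [mem_smul_set_iff_inv_smul_mem₀ hr.ne', mem_ofPred_eq, mem_ofPred_eq,
      h.map_smul_of_nonneg (by positivity), inv_mul_lt_iff₀ hr, mul_one]
  rw [h1, Measure.addHaar_smul, finrank_euclideanSpace_fin, abs_of_nonneg (by positivity), mul_comm,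
    ENNReal.ofReal_mul h.unitVol_pos.le, unitVol, ENNReal.ofReal_toReal (h.volume_ball_lt_top 1).ne]

lemma lintegral_Ioo_pow (h : IsFinslerNorm N F) (hN : N ≠ 0) {r : ℝ} (hr : 0 ≤ r) :
    ∫⁻ s in Ioo 0 r, ENNReal.ofReal (N * unitVol F * s ^ (N - 1))
      = ENNReal.ofReal (unitVol F * r ^ N) := by
  have hκ := h.unitVol_pos
  rw [← ofReal_integral_eq_lintegral_ofReal]
  · congr 1
    rw [← integral_Ioc_eq_integral_Ioo, ← intervalIntegral.integral_of_le hr,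
      intervalIntegral.integral_const_mul, integral_pow]
    have h1 : ((N - 1 : ℕ) : ℝ) + 1 = N := by
      rw [Nat.cast_sub (by omega)]; simp
    have h2 : N - 1 + 1 = N := by omega
    have h3 : (N : ℝ) ≠ 0 := by exact_mod_cast hN
    rw [h1, h2, zero_pow hN]
    field_simp
    ring
  · exact (Continuous.integrableOn_Icc (by fun_prop)).mono_set Ioo_subset_Icc_self
  · filter_upwards [ae_restrict_mem measurableSet_Ioo] with s hs
    have := hs.1
    positivity

/-- Integration of radial functions in polar coordinates adapted to `F`. -/
lemma lintegral_radial [Nontrivial (Euc N)] (h : IsFinslerNorm N F) {φ : ℝ → ENNReal}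
    (hφ : Measurable φ) :
    ∫⁻ z, φ (F z) = ∫⁻ s in Ioi 0, ENNReal.ofReal (N * unitVol F * s ^ (N - 1)) * φ s := by
  have hN : N ≠ 0 := by
    rintro rfl
    exact not_subsingleton (Euc 0) inferInstance
  have hd : Measurable fun s : ℝ => ENNReal.ofReal (N * unitVol F * s ^ (N - 1)) := by fun_prop
  have hm : Measurable F := h.continuous.measurable
  have key : Measure.map F volume = (volume.restrict (Ioi 0)).withDensity
      (fun s : ℝ => ENNReal.ofReal (N * unitVol F * s ^ (N - 1))) := by
    have hl : ∀ r : ℝ, Measure.map F volume (Iio r) = ENNReal.ofReal (unitVol F * (max r 0) ^ N) := by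
      intro r
      rw [Measure.map_apply hm measurableSet_Iio]
      rw [← h.volume_ball _ (le_max_right r 0)]
      congr 1
      ext x
      simp only [mem_preimage, mem_Iio, mem_ofPred_eq, lt_max_iff]
      exact ⟨Or.inl, fun hx => hx.resolve_right (h.nonneg x).not_gt⟩
    refine Measure.ext_of_generateFrom_of_iUnion (range Iio) (fun n : ℕ => Iio (n : ℝ))
      (borel_eq_generateFrom_Iio ℝ ▸ BorelSpace.measurable_eq) ?_ ?_ (fun n => ⟨_, rfl⟩)
      (fun n => ?_) ?_
    · exact isPiSystem_Iio
    · refine eq_univ_of_forall fun x => mem_iUnion.2 ?_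
      exact exists_nat_gt x
    · rw [hl]; exact ENNReal.ofReal_ne_top
    · rintro _ ⟨r, rfl⟩
      rw [hl, withDensity_apply _ measurableSet_Iio, Measure.restrict_restrict measurableSet_Iio,
        ← h.lintegral_Ioo_pow hN (le_max_right r 0)]
      congr 2
      ext s
      simp only [mem_Ioo, mem_inter_iff, mem_Iio, mem_Ioi, lt_max_iff]
      constructor
      · rintro ⟨h1, h2 | h2⟩
        · exact ⟨h2, h1⟩
        · linarith
      · rintro ⟨h1, h2⟩
        exact ⟨h2, Or.inl h1⟩
  rw [← lintegral_map hφ hm, key, lintegral_withDensity_eq_lintegral_mul _ hd hφ]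
  rfl

lemma setLIntegral_radial [Nontrivial (Euc N)] (h : IsFinslerNorm N F) {φ : ℝ → ENNReal}
    (hφ : Measurable φ) {S : Set ℝ} (hS : MeasurableSet S) :
    ∫⁻ z in {z | F z ∈ S}, φ (F z)
      = ∫⁻ s in S ∩ Ioi 0, ENNReal.ofReal (N * unitVol F * s ^ (N - 1)) * φ s := by
  have hm : MeasurableSet {z | F z ∈ S} := h.continuous.measurable hS
  rw [← lintegral_indicator hm, ← Measure.restrict_restrict hS, ← lintegral_indicator hS]
  have h1 := h.lintegral_radial (hφ.indicator hS)
  have h2 : (fun z => S.indicator φ (F z)) = {z | F z ∈ S}.indicator (fun z => φ (F z)) := by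
    ext z
    simp [indicator]
  rw [h2] at h1
  rw [h1]
  congr 1
  ext s
  simp [indicator]

/-- The integral of `F ^ (-N)` on an annulus. -/
lemma lintegral_annulus [Nontrivial (Euc N)] (h : IsFinslerNorm N F) {δ R : ℝ} (hδ : 0 < δ)
    (hR : δ ≤ R) :
    ∫⁻ z in {z | F z ∈ Ico δ R}, ENNReal.ofReal (F z ^ (-(N : ℝ)))
      = ENNReal.ofReal (N * unitVol F * Real.log (R / δ)) := by
  have hN : N ≠ 0 := by
    rintro rfl
    exact not_subsingleton (Euc 0) inferInstance
  have hκ := h.unitVol_pos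
  rw [h.setLIntegral_radial (φ := fun s => ENNReal.ofReal (s ^ (-(N : ℝ)))) (by fun_prop)
    measurableSet_Ico]
  have h1 : Ico δ R ∩ Ioi 0 = Ico δ R := inter_eq_left.2 fun s hs => hδ.trans_le hs.1
  rw [h1, setLIntegral_congr_fun (g := fun s => ENNReal.ofReal (N * unitVol F * s⁻¹)) measurableSet_Ico]
  · rw [← ofReal_integral_eq_lintegral_ofReal]
    · congr 1
      rw [integral_Ico_eq_integral_Ioc, ← intervalIntegral.integral_of_le hR,
        intervalIntegral.integral_const_mul, integral_inv_of_pos hδ (hδ.trans_le hR)]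
    · refine (ContinuousOn.integrableOn_Icc ?_).mono_set Ico_subset_Icc_self
      exact continuousOn_const.mul (continuousOn_inv₀.mono fun s hs => (hδ.trans_le hs.1).ne')
    · filter_upwards [ae_restrict_mem measurableSet_Ico] with s hs
      have := hδ.trans_le hs.1
      positivity
  · intro s hs
    have hs : 0 < s := hδ.trans_le hs.1
    simp only
    rw [← ENNReal.ofReal_mul (by positivity)]
    congr 1
    rw [rpow_neg hs.le, rpow_natCast, ← pow_sub_one_mul hN s]
    field_simp

/-- The integral of `F ^ (-γ)` on a ball, for `γ < N`. -/
lemma lintegral_ball_rpow [Nontrivial (Euc N)] (h : IsFinslerNorm N F) {γ r : ℝ} (hγ : γ < N)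
    (hr : 0 ≤ r) :
    ∫⁻ z in {z | F z ∈ Iio r}, ENNReal.ofReal (F z ^ (-γ))
      = ENNReal.ofReal (N * unitVol F / (N - γ) * r ^ (N - γ)) := by
  have hN : N ≠ 0 := by
    rintro rfl
    exact not_subsingleton (Euc 0) inferInstance
  have hκ := h.unitVol_pos
  have hγ' : 0 < (N : ℝ) - γ := by linarith
  have h1 : Iio r ∩ Ioi 0 = Ioo 0 r := by ext s; simp [and_comm]
  rw [h.setLIntegral_radial (φ := fun s => ENNReal.ofReal (s ^ (-γ))) (by fun_prop)
    measurableSet_Iio, h1,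
    setLIntegral_congr_fun (g := fun s => ENNReal.ofReal (N * unitVol F * s ^ (N - γ - 1)))
      measurableSet_Ioo]
  · rw [← ofReal_integral_eq_lintegral_ofReal]
    · congr 1
      rw [← integral_Ioc_eq_integral_Ioo, ← intervalIntegral.integral_of_le hr,
        intervalIntegral.integral_const_mul, integral_rpow (Or.inl (by linarith)), sub_add_cancel,
        zero_rpow hγ'.ne']
      ring
    · have := (intervalIntegral.intervalIntegrable_rpow' (a := 0) (b := r)
        (show (-1 : ℝ) < N - γ - 1 by linarith)).const_mul (N * unitVol F)
      rw [intervalIntegrable_iff_integrableOn_Ioc_of_le hr] at this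
      exact this.mono_set Ioo_subset_Ioc_self
    · filter_upwards [ae_restrict_mem measurableSet_Ioo] with s hs
      have := hs.1
      positivity
  · intro s hs
    have hs : 0 < s := hs.1
    simp only
    rw [← ENNReal.ofReal_mul (by positivity)]
    congr 1
    rw [mul_assoc]
    congr 1
    rw [← rpow_natCast, ← rpow_add hs, Nat.cast_sub (by omega)]
    congr 1
    push_cast
    ring

end IsFinslerNorm

/-! ### A pointwise bound by the Riesz potential of the gradient -/

lemma lintegral_comp_smul_euc {N : ℕ} {Ψ : Euc N → ENNReal} (hΨ : Measurable Ψ) {s : ℝ}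
    (hs : 0 < s) :
    ∫⁻ z, Ψ (s • z) = ENNReal.ofReal (s ^ (-(N : ℝ))) * ∫⁻ y, Ψ y := by
  rw [← lintegral_map hΨ (measurable_const_smul s), Measure.map_addHaar_smul _ hs.ne',
    lintegral_smul_measure, finrank_euclideanSpace_fin, abs_of_nonneg (by positivity),
    rpow_neg hs.le, rpow_natCast, smul_eq_mul]

lemma continuous_gradient {N : ℕ} {u : Euc N → ℝ} (hu : ContDiff ℝ 1 u) :
    Continuous (gradient u) :=
  (InnerProductSpace.toDual ℝ (Euc N)).symm.continuous.comp (hu.continuous_fderiv (by norm_num))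

lemma ofReal_abs_le_lintegral_ray {N : ℕ} {H : Euc N → ℝ} (hH : IsFinslerNorm N H)
    {u : Euc N → ℝ} (hu : ContDiff ℝ 1 u) (hc : HasCompactSupport u) (x : Euc N) {z : Euc N}
    (hz : z ≠ 0) :
    ENNReal.ofReal |u x| ≤
      ∫⁻ s in Ioi (0 : ℝ), ENNReal.ofReal (H (gradient u (x + s • z)) * dualNorm H z) := by
  have hd : ∀ s : ℝ, HasDerivAt (fun s : ℝ => u (x + s • z)) ⟪gradient u (x + s • z), z⟫ s := by
    intro s
    have h2 : HasFDerivAt u (fderiv ℝ u (x + s • z)) (x + s • z) :=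
      (hu.differentiable (by norm_num) _).hasFDerivAt
    have h3 : HasDerivAt (fun t : ℝ => x + t • z) z s := by
      simpa using ((hasDerivAt_id s).smul_const z).const_add x
    rw [inner_gradient_left]
    exact h2.comp_hasDerivAt _ h3
  have hcont : Continuous fun s : ℝ => ⟪gradient u (x + s • z), z⟫ := by
    have := continuous_gradient hu
    fun_prop
  obtain ⟨T, hT0, hT⟩ : ∃ T : ℝ, 0 < T ∧ u (x + T • z) = 0 := by
    obtain ⟨B, hB⟩ := hc.isCompact.isBounded.exists_norm_le
    have hz' : 0 < ‖z‖ := norm_pos_iff.2 hz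
    refine ⟨(|B| + ‖x‖ + 1) / ‖z‖, by positivity, ?_⟩
    by_contra hne
    have h1 := hB _ (subset_tsupport u hne)
    have h2 : ‖((|B| + ‖x‖ + 1) / ‖z‖) • z‖ = |B| + ‖x‖ + 1 := by
      rw [norm_smul, norm_of_nonneg (by positivity)]
      field_simp
    have h3 := norm_sub_le (x + ((|B| + ‖x‖ + 1) / ‖z‖) • z) x
    rw [add_sub_cancel_left, h2] at h3
    linarith [le_abs_self B]
  have hint := intervalIntegral.integral_eq_sub_of_hasDerivAt (a := 0) (b := T) (fun s _ => hd s)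
    (hcont.intervalIntegrable _ _)
  rw [hT, zero_smul, add_zero, zero_sub, intervalIntegral.integral_of_le hT0.le] at hint
  calc ENNReal.ofReal |u x| = ‖∫ s in Ioc 0 T, ⟪gradient u (x + s • z), z⟫‖ₑ := by
        rw [hint, enorm_neg, Real.enorm_eq_ofReal_abs]
    _ ≤ ∫⁻ s in Ioc 0 T, ‖⟪gradient u (x + s • z), z⟫‖ₑ := enorm_integral_le_lintegral_enorm _
    _ ≤ ∫⁻ s in Ioi (0 : ℝ), ‖⟪gradient u (x + s • z), z⟫‖ₑ :=
        lintegral_mono_set fun s hs => hs.1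
    _ ≤ _ := by
        refine lintegral_mono fun s => ?_
        rw [Real.enorm_eq_ofReal_abs]
        refine ENNReal.ofReal_le_ofReal ?_
        rw [real_inner_comm, mul_comm]
        exact hH.abs_inner_le _ _

lemma lintegral_Ioi_rpow {a c : ℝ} (ha : a < -1) (hc : 0 < c) :
    ∫⁻ s in Ioi c, ENNReal.ofReal (s ^ a) = ENNReal.ofReal (-c ^ (a + 1) / (a + 1)) := by
  rw [← ofReal_integral_eq_lintegral_ofReal (integrableOn_Ioi_rpow_of_lt ha hc),
    integral_Ioi_rpow_of_lt ha hc]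
  filter_upwards [ae_restrict_mem measurableSet_Ioi] with s hs
  exact rpow_nonneg (hc.trans hs).le _

/-- A compactly supported function is bounded by the Riesz potential of its gradient, with the
sharp constant. -/
lemma ofReal_abs_le_riesz {N : ℕ} [Nontrivial (Euc N)] {H : Euc N → ℝ} (hH : IsFinslerNorm N H)
    {u : Euc N → ℝ} (hu : ContDiff ℝ 1 u) (hc : HasCompactSupport u) (x : Euc N) :
    ENNReal.ofReal (N * unitVol (dualNorm H) * |u x|) ≤
      ∫⁻ y, ENNReal.ofReal (H (gradient u (x + y)) * dualNorm H y ^ (1 - (N : ℝ))) := by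
  have hF := hH.dual
  set F := dualNorm H with hFdef
  have hN : N ≠ 0 := by
    rintro rfl
    exact not_subsingleton (Euc 0) inferInstance
  have hN' : (0 : ℝ) < N := by exact_mod_cast Nat.pos_of_ne_zero hN
  have hκ := hF.unitVol_pos
  have hFc := hF.continuous
  have hHc := hH.continuous
  have hgc := continuous_gradient hu
  have hWm : MeasurableSet {z | F z < 1} := (hF.isOpen_ball 1).measurableSet
  have hvol : volume {z | F z < 1} = ENNReal.ofReal (unitVol F) := by
    simpa using hF.volume_ball 1 zero_le_one
  let Ψ : ℝ → Euc N → ENNReal := fun s y =>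
    {y | F y < s}.indicator (fun y => ENNReal.ofReal (H (gradient u (x + y)) * F y / s)) y
  have hΨ : ∀ s, Measurable (Ψ s) := fun s =>
    Measurable.indicator (by fun_prop) (hF.isOpen_ball s).measurableSet
  have h1 : ENNReal.ofReal |u x| * ENNReal.ofReal (unitVol F) ≤
      ∫⁻ z in {z | F z < 1}, ∫⁻ s in Ioi (0 : ℝ),
        ENNReal.ofReal (H (gradient u (x + s • z)) * F z) := by
    rw [← hvol, ← setLIntegral_const]
    refine lintegral_mono_ae (ae_restrict_of_ae ?_)
    filter_upwards [compl_mem_ae_iff.2 (measure_singleton (0 : Euc N))] with z hz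
    exact ofReal_abs_le_lintegral_ray hH hu hc x hz
  have h2 : ∫⁻ z in {z | F z < 1}, ∫⁻ s in Ioi (0 : ℝ),
        ENNReal.ofReal (H (gradient u (x + s • z)) * F z)
      = ∫⁻ s in Ioi (0 : ℝ), ∫⁻ z in {z | F z < 1},
        ENNReal.ofReal (H (gradient u (x + s • z)) * F z) := by
    refine lintegral_lintegral_swap (Measurable.aemeasurable ?_)
    unfold Function.uncurry
    fun_prop
  have h3 : ∀ s ∈ Ioi (0 : ℝ), ∫⁻ z in {z | F z < 1},
        ENNReal.ofReal (H (gradient u (x + s • z)) * F z)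
      = ∫⁻ y, ENNReal.ofReal (s ^ (-(N : ℝ))) * Ψ s y := by
    intro s hs
    have hs : 0 < s := hs
    rw [lintegral_const_mul _ (hΨ s), ← lintegral_comp_smul_euc (hΨ s) hs,
      ← lintegral_indicator hWm]
    congr 1
    ext z
    have hiff : F (s • z) < s ↔ F z < 1 := by
      rw [hF.map_smul_of_nonneg hs.le, mul_lt_iff_lt_one_right hs]
    by_cases hz : F z < 1
    · simp only [Ψ]
      rw [indicator_of_mem (by exact hz), indicator_of_mem (by exact hiff.2 hz),
        hF.map_smul_of_nonneg hs.le]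
      congr 1
      field_simp
    · simp only [Ψ]
      rw [indicator_of_notMem (by exact hz), indicator_of_notMem (by exact fun h => hz (hiff.1 h))]
  have h4 : ∫⁻ s in Ioi (0 : ℝ), ∫⁻ y, ENNReal.ofReal (s ^ (-(N : ℝ))) * Ψ s y
      = ∫⁻ y, ∫⁻ s in Ioi (0 : ℝ), ENNReal.ofReal (s ^ (-(N : ℝ))) * Ψ s y := by
    refine lintegral_lintegral_swap (Measurable.aemeasurable ?_)
    have : Measurable fun q : ℝ × Euc N => Ψ q.1 q.2 := by
      have hm : MeasurableSet {q : ℝ × Euc N | F q.2 < q.1} :=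
        (isOpen_lt (by fun_prop) (by fun_prop)).measurableSet
      have hm2 : Measurable fun q : ℝ × Euc N =>
          ENNReal.ofReal (H (gradient u (x + q.2)) * F q.2 / q.1) := by fun_prop
      exact hm2.indicator hm
    unfold Function.uncurry
    fun_prop
  have h5 : ∀ y : Euc N, ∫⁻ s in Ioi (0 : ℝ), ENNReal.ofReal (s ^ (-(N : ℝ))) * Ψ s y
      ≤ ENNReal.ofReal ((N : ℝ)⁻¹) *
        ENNReal.ofReal (H (gradient u (x + y)) * F y ^ (1 - (N : ℝ))) := by
    intro y
    have hA := hH.nonneg (gradient u (x + y))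
    rcases eq_or_ne y 0 with rfl | hy
    · have h0 : ∀ s, Ψ s 0 = 0 := fun s => by simp [Ψ, indicator_apply, hF.map_zero]
      simp [h0]
    have hy := hF.pos hy
    refine le_of_eq ?_
    calc ∫⁻ s in Ioi (0 : ℝ), ENNReal.ofReal (s ^ (-(N : ℝ))) * Ψ s y
        = ∫⁻ s in Ioi (0 : ℝ), (Ioi (F y)).indicator (fun s =>
          ENNReal.ofReal (H (gradient u (x + y)) * F y) * ENNReal.ofReal (s ^ (-(N : ℝ) - 1))) s := by
          refine setLIntegral_congr_fun measurableSet_Ioi fun s hs => ?_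
          have hs : 0 < s := hs
          by_cases h : F y < s
          · simp only [Ψ]
            rw [indicator_of_mem (by exact h), indicator_of_mem (by exact h),
              ← ENNReal.ofReal_mul (by positivity), ← ENNReal.ofReal_mul (by positivity),
              rpow_sub_one hs.ne']
            congr 1
            ring
          · simp only [Ψ]
            rw [indicator_of_notMem (by exact h), indicator_of_notMem (by exact h), mul_zero]
      _ = ∫⁻ s in Ioi (F y),
          ENNReal.ofReal (H (gradient u (x + y)) * F y) * ENNReal.ofReal (s ^ (-(N : ℝ) - 1)) := by
          rw [lintegral_indicator measurableSet_Ioi, Measure.restrict_restrict measurableSet_Ioi,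
            inter_eq_left.2 (Ioi_subset_Ioi hy.le)]
      _ = ENNReal.ofReal ((N : ℝ)⁻¹) *
          ENNReal.ofReal (H (gradient u (x + y)) * F y ^ (1 - (N : ℝ))) := by
          rw [lintegral_const_mul _ (by fun_prop), lintegral_Ioi_rpow (by linarith) hy,
            ← ENNReal.ofReal_mul (by positivity), ← ENNReal.ofReal_mul (by positivity)]
          congr 1
          rw [sub_add_cancel, show (1 : ℝ) - N = 1 + -N by ring, rpow_add hy, rpow_one]
          generalize F y ^ (-(N : ℝ)) = P
          field_simp
  calc ENNReal.ofReal (N * unitVol F * |u x|)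
      = ENNReal.ofReal N * (ENNReal.ofReal |u x| * ENNReal.ofReal (unitVol F)) := by
        rw [← ENNReal.ofReal_mul (by positivity), ← ENNReal.ofReal_mul (by positivity)]
        congr 1
        ring
    _ ≤ ENNReal.ofReal N * ∫⁻ y, ENNReal.ofReal ((N : ℝ)⁻¹) *
        ENNReal.ofReal (H (gradient u (x + y)) * F y ^ (1 - (N : ℝ))) := by
        gcongr
        refine h1.trans ?_
        rw [h2, setLIntegral_congr_fun measurableSet_Ioi h3, h4]
        exact lintegral_mono h5
    _ = _ := by
        rw [lintegral_const_mul _ (by fun_prop), ← mul_assoc, ← ENNReal.ofReal_mul hN'.le,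
          mul_inv_cancel₀ hN'.ne', ENNReal.ofReal_one, one_mul]

/-! ### Sharp `L^q` bounds -/

lemma holderConjugate_dim {N : ℕ} (hN : 2 ≤ N) :
    (N : ℝ).HolderConjugate ((1 - (N : ℝ)⁻¹)⁻¹) := by
  have hN' : (2 : ℝ) ≤ N := by exact_mod_cast hN
  rw [Real.holderConjugate_iff]
  refine ⟨by linarith, ?_⟩
  rw [inv_inv]
  ring

lemma one_sub_inv_pos {N : ℕ} (hN : 2 ≤ N) : 0 < 1 - (N : ℝ)⁻¹ := by
  have hN' : (2 : ℝ) ≤ N := by exact_mod_cast hN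
  rw [sub_pos]
  exact inv_lt_one_of_one_lt₀ (by linarith)

/-- Near/far decomposition of the Riesz potential. -/
lemma riesz_split {N : ℕ} (hN : 2 ≤ N) [Nontrivial (Euc N)] {F : Euc N → ℝ}
    (hF : IsFinslerNorm N F) {f : Euc N → ℝ} (hfc : Continuous f) (hf0 : ∀ y, 0 ≤ f y)
    {R δ a : ℝ} (hδ : 0 < δ) (hδR : δ ≤ R) (ha : 0 < a) (hfR : ∀ y, R ≤ F y → f y = 0)
    (hf1 : ∫⁻ y, ENNReal.ofReal (f y ^ N) ≤ 1) :
    ∫⁻ y, ENNReal.ofReal (f y * F y ^ (1 - (N : ℝ))) ≤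
      (∫⁻ y, ENNReal.ofReal (f y ^ N * F y ^ (-a))) ^ (1 / (N : ℝ)) *
        ENNReal.ofReal ((N * unitVol F * (N - 1) / a * δ ^ (a / (N - 1))) ^ (1 - (N : ℝ)⁻¹))
      + ENNReal.ofReal ((N * unitVol F * Real.log (R / δ)) ^ (1 - (N : ℝ)⁻¹)) := by
  have hN' : (2 : ℝ) ≤ N := by exact_mod_cast hN
  have hN1 : (0 : ℝ) < N - 1 := by linarith
  have hθ := one_sub_inv_pos hN
  have hκ := hF.unitVol_pos
  have hFc := hF.continuous
  have hconj := holderConjugate_dim hN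
  set I : Set (Euc N) := {y | F y ∈ Iio δ} with hI
  set A : Set (Euc N) := {y | F y ∈ Ico δ R} with hA
  have hIm : MeasurableSet I := hFc.measurable measurableSet_Iio
  have hAm : MeasurableSet A := hFc.measurable measurableSet_Ico
  have hpowN : ∀ t : ℝ, 0 ≤ t → ENNReal.ofReal t ^ (N : ℝ) = ENNReal.ofReal (t ^ N) := fun t ht => by
    rw [ENNReal.ofReal_rpow_of_nonneg ht (by positivity), rpow_natCast]
  have hne : ∀ᵐ y : Euc N, y ≠ 0 := compl_mem_ae_iff.2 (measure_singleton (0 : Euc N))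
  have hsub : ∫⁻ y, ENNReal.ofReal (f y * F y ^ (1 - (N : ℝ))) ≤
      (∫⁻ y in I, ENNReal.ofReal (f y * F y ^ (1 - (N : ℝ))))
      + ∫⁻ y in A, ENNReal.ofReal (f y * F y ^ (1 - (N : ℝ))) := by
    rw [← lintegral_indicator hIm, ← lintegral_indicator hAm, ← lintegral_add_left
      (Measurable.indicator (by fun_prop) hIm)]
    refine lintegral_mono fun y => ?_
    rcases lt_or_ge (F y) δ with h1 | h1
    · rw [indicator_of_mem (show y ∈ I from h1)]
      exact le_self_add
    · rcases lt_or_ge (F y) R with h2 | h2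
      · rw [indicator_of_mem (show y ∈ A from ⟨h1, h2⟩)]
        exact le_add_self
      · simp [hfR y h2]
  have hin : ∫⁻ y in I, ENNReal.ofReal (f y * F y ^ (1 - (N : ℝ))) ≤
      (∫⁻ y, ENNReal.ofReal (f y ^ N * F y ^ (-a))) ^ (1 / (N : ℝ)) *
        ENNReal.ofReal ((N * unitVol F * (N - 1) / a * δ ^ (a / (N - 1))) ^ (1 - (N : ℝ)⁻¹)) := by
    calc ∫⁻ y in I, ENNReal.ofReal (f y * F y ^ (1 - (N : ℝ)))
        = ∫⁻ y in I, ((fun y => ENNReal.ofReal (f y * F y ^ (-a / N))) *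
            fun y => ENNReal.ofReal (F y ^ (1 - (N : ℝ) + a / N))) y := by
          refine lintegral_congr_ae (ae_restrict_of_ae ?_)
          filter_upwards [hne] with y hy
          have hy := hF.pos hy
          have := hf0 y
          rw [Pi.mul_apply, ← ENNReal.ofReal_mul (by positivity), mul_assoc, ← rpow_add hy]
          congr 3
          ring
      _ ≤ (∫⁻ y in I, ENNReal.ofReal (f y * F y ^ (-a / N)) ^ (N : ℝ)) ^ (1 / (N : ℝ)) *
          (∫⁻ y in I, ENNReal.ofReal (F y ^ (1 - (N : ℝ) + a / N)) ^ ((1 - (N : ℝ)⁻¹)⁻¹)) ^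
            (1 / ((1 - (N : ℝ)⁻¹)⁻¹)) :=
          ENNReal.lintegral_mul_le_Lp_mul_Lq _ hconj (by fun_prop) (by fun_prop)
      _ ≤ _ := by
          gcongr ?_ ^ _ * ?_
          · refine (setLIntegral_le_lintegral _ _).trans (lintegral_mono fun y => ?_)
            have h0 := hF.nonneg y
            have := hf0 y
            rw [hpowN _ (by positivity), mul_pow, ← rpow_natCast (F y ^ (-a / N)), ← rpow_mul h0,
              div_mul_cancel₀ _ (by positivity)]
          · have h1 : ∫⁻ y in I, ENNReal.ofReal (F y ^ (1 - (N : ℝ) + a / N)) ^ ((1 - (N : ℝ)⁻¹)⁻¹)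
                = ∫⁻ y in I, ENNReal.ofReal (F y ^ (-((N : ℝ) - a / (N - 1)))) := by
              congr 1
              ext y
              have h0 := hF.nonneg y
              rw [ENNReal.ofReal_rpow_of_nonneg (by positivity) (by positivity), ← rpow_mul h0]
              congr 2
              field_simp
              ring
            have h2 : (N : ℝ) - a / (N - 1) < N := by
              have : 0 < a / (N - 1) := by positivity
              linarith
            rw [h1, hF.lintegral_ball_rpow h2 hδ.le, one_div, inv_inv, sub_sub_cancel,
              ENNReal.ofReal_rpow_of_nonneg (by positivity) hθ.le]
            rw [div_div_eq_mul_div]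
  have hout : ∫⁻ y in A, ENNReal.ofReal (f y * F y ^ (1 - (N : ℝ))) ≤
      ENNReal.ofReal ((N * unitVol F * Real.log (R / δ)) ^ (1 - (N : ℝ)⁻¹)) := by
    calc ∫⁻ y in A, ENNReal.ofReal (f y * F y ^ (1 - (N : ℝ)))
        = ∫⁻ y in A, ((fun y => ENNReal.ofReal (f y)) *
            fun y => ENNReal.ofReal (F y ^ (1 - (N : ℝ)))) y := by
          simp_rw [Pi.mul_apply, ENNReal.ofReal_mul (hf0 _)]
      _ ≤ (∫⁻ y in A, ENNReal.ofReal (f y) ^ (N : ℝ)) ^ (1 / (N : ℝ)) *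
          (∫⁻ y in A, ENNReal.ofReal (F y ^ (1 - (N : ℝ))) ^ ((1 - (N : ℝ)⁻¹)⁻¹)) ^
            (1 / ((1 - (N : ℝ)⁻¹)⁻¹)) :=
          ENNReal.lintegral_mul_le_Lp_mul_Lq _ hconj (by fun_prop) (by fun_prop)
      _ ≤ 1 * ENNReal.ofReal ((N * unitVol F * Real.log (R / δ)) ^ (1 - (N : ℝ)⁻¹)) := by
          refine mul_le_mul' ?_ ?_
          · refine ENNReal.rpow_le_one ?_ (by positivity)
            refine (setLIntegral_le_lintegral _ _).trans (le_trans (lintegral_mono fun y => ?_) hf1)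
            rw [hpowN _ (hf0 y)]
          · have h1 : ∫⁻ y in A, ENNReal.ofReal (F y ^ (1 - (N : ℝ))) ^ ((1 - (N : ℝ)⁻¹)⁻¹)
                = ∫⁻ y in A, ENNReal.ofReal (F y ^ (-(N : ℝ))) := by
              congr 1
              ext y
              have h0 := hF.nonneg y
              rw [ENNReal.ofReal_rpow_of_nonneg (by positivity) (by positivity), ← rpow_mul h0]
              congr 2
              field_simp
              ring
            have hlog : 0 ≤ Real.log (R / δ) := Real.log_nonneg ((one_le_div hδ).2 hδR)
            rw [h1, hF.lintegral_annulus hδ hδR, one_div, inv_inv,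
              ENNReal.ofReal_rpow_of_nonneg (by positivity) hθ.le]
      _ = _ := one_mul _
  exact hsub.trans (add_le_add hin hout)

lemma log_le_div_exp_one {x : ℝ} (hx : 0 < x) : Real.log x ≤ x / Real.exp 1 := by
  have h := Real.log_le_sub_one_of_pos (div_pos hx (Real.exp_pos 1))
  rw [Real.log_div hx.ne' (Real.exp_pos 1).ne', Real.log_exp] at h
  linarith

lemma log_rpow_le {P q θ : ℝ} (hP : 1 ≤ P) (hq : 0 < q) (hθ : 0 < θ) :
    Real.log P ^ θ ≤ (q * θ / Real.exp 1) ^ θ * P ^ (1 / q) := by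
  have hP0 : 0 < P := by linarith
  have h1 : Real.log P ≤ q * θ / Real.exp 1 * P ^ (1 / (q * θ)) := by
    have h2 := log_le_div_exp_one (rpow_pos_of_pos hP0 (1 / (q * θ)))
    rw [Real.log_rpow hP0, one_div, inv_mul_le_iff₀ (by positivity)] at h2
    refine h2.trans (le_of_eq ?_)
    rw [one_div]
    ring
  refine (rpow_le_rpow (Real.log_nonneg hP) h1 hθ.le).trans (le_of_eq ?_)
  rw [mul_rpow (by positivity) (by positivity), ← rpow_mul hP0.le]
  congr 2
  field_simp

/-- The coefficient of the leading term in the `L^q` bound. -/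
def rieszCoeff (N : ℕ) (κ a : ℝ) : ℝ :=
  (N * κ / a * ((1 - (N : ℝ)⁻¹) / Real.exp 1)) ^ (1 - (N : ℝ)⁻¹) / (N * κ)

/-- The lower-order term in the `L^q` bound. -/
def rieszRemainder (N : ℕ) (κ a : ℝ) : ℝ :=
  (N * κ * (N - 1) / a) ^ (1 - (N : ℝ)⁻¹) / (N * κ)

lemma pointwise_bound {N : ℕ} (hN : 2 ≤ N) [Nontrivial (Euc N)] {F : Euc N → ℝ}
    (hF : IsFinslerNorm N F) {f : Euc N → ℝ} (hfc : Continuous f) (hf0 : ∀ y, 0 ≤ f y)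
    {R a q t : ℝ} (hR : 0 < R) (ha : 0 < a) (hq : 0 < q) (hfR : ∀ y, R ≤ F y → f y = 0)
    (hf1 : ∫⁻ y, ENNReal.ofReal (f y ^ N) ≤ 1) (ht : 0 ≤ t)
    (htf : ENNReal.ofReal (N * unitVol F * t) ≤
      ∫⁻ y, ENNReal.ofReal (f y * F y ^ (1 - (N : ℝ)))) :
    ENNReal.ofReal (t ^ q) ≤ ENNReal.ofReal
      ((rieszRemainder N (unitVol F) a + rieszCoeff N (unitVol F) a * q ^ (1 - (N : ℝ)⁻¹)) ^ q) *
      (1 + ENNReal.ofReal (R ^ a) * ∫⁻ y, ENNReal.ofReal (f y ^ N * F y ^ (-a))) := by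
  have hN' : (2 : ℝ) ≤ N := by exact_mod_cast hN
  have hN1 : (0 : ℝ) < N - 1 := by linarith
  have hθ := one_sub_inv_pos hN
  have hκ := hF.unitVol_pos
  set G := ∫⁻ y, ENNReal.ofReal (f y ^ N * F y ^ (-a)) with hG
  set κ := unitVol F with hκd
  have hc0 : 0 < rieszRemainder N κ a := by unfold rieszRemainder; positivity
  have hB0 : 0 < rieszCoeff N κ a := by unfold rieszCoeff; positivity
  rcases eq_or_ne G ⊤ with hGt | hGt
  · have h1 : ENNReal.ofReal (R ^ a) ≠ 0 := by
      simpa using rpow_pos_of_pos hR a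
    have h2 : ENNReal.ofReal ((rieszRemainder N κ a + rieszCoeff N κ a * q ^ (1 - (N : ℝ)⁻¹)) ^ q)
        ≠ 0 := by
      simp only [ne_eq, ENNReal.ofReal_eq_zero, not_le]
      positivity
    rw [hGt, ENNReal.mul_top h1, add_top, ENNReal.mul_top h2]
    exact le_top
  set g := G.toReal with hg
  have hg0 : 0 ≤ g := ENNReal.toReal_nonneg
  have hGg : G = ENNReal.ofReal g := (ENNReal.ofReal_toReal hGt).symm
  set P := 1 + R ^ a * g with hP
  have hRa : 0 < R ^ a := rpow_pos_of_pos hR a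
  have hP1 : 1 ≤ P := by
    have : 0 ≤ R ^ a * g := by positivity
    linarith
  have hP0 : 0 < P := by linarith
  set δ := R * P ^ (-(1 / a)) with hδd
  have hδ : 0 < δ := by positivity
  have hPinv : P ^ (-(1 / a)) ≤ 1 :=
    rpow_le_one_of_one_le_of_nonpos hP1 (by simpa using ha.le)
  have hδR : δ ≤ R := mul_le_of_le_one_right hR.le hPinv
  have hlog : Real.log (R / δ) = Real.log P / a := by
    have : R / δ = P ^ (1 / a) := by
      rw [hδd, rpow_neg hP0.le]
      field_simp
    rw [this, Real.log_rpow hP0]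
    ring
  have hgδ : g * δ ^ a ≤ 1 := by
    rw [hδd, mul_rpow hR.le (by positivity), ← rpow_mul hP0.le, neg_mul, one_div,
      inv_mul_cancel₀ ha.ne', rpow_neg_one, ← mul_assoc, ← div_eq_mul_inv, div_le_one hP0]
    linarith
  have hsplit := htf.trans (riesz_split hN hF hfc hf0 hδ hδR ha hfR hf1)
  rw [← hG, ← hκd, hGg, ENNReal.ofReal_rpow_of_nonneg hg0 (by positivity),
    ← ENNReal.ofReal_mul (by positivity), hlog,
    mul_rpow (by positivity : 0 ≤ N * κ * (N - 1) / a) (by positivity), ← rpow_mul hδ.le] at hsplit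
  have hlogP := Real.log_nonneg hP1
  rw [← ENNReal.ofReal_add (by positivity) (by positivity),
    ENNReal.ofReal_le_ofReal_iff (by positivity)] at hsplit
  have hexp : a / (N - 1) * (1 - (N : ℝ)⁻¹) = a * (1 / N) := by field_simp
  have hfirst : g ^ (1 / (N : ℝ)) * ((N * κ * (N - 1) / a) ^ (1 - (N : ℝ)⁻¹) *
      δ ^ (a / (N - 1) * (1 - (N : ℝ)⁻¹))) ≤ N * κ * rieszRemainder N κ a := by
    have h1 : N * κ * rieszRemainder N κ a = (N * κ * (N - 1) / a) ^ (1 - (N : ℝ)⁻¹) := by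
      unfold rieszRemainder; field_simp
    rw [h1, hexp, rpow_mul hδ.le, mul_left_comm, ← mul_rpow hg0 (by positivity)]
    exact mul_le_of_le_one_right (by positivity)
      (rpow_le_one (by positivity) hgδ (by positivity))
  have hsecond : (N * κ * (Real.log P / a)) ^ (1 - (N : ℝ)⁻¹) ≤
      N * κ * (rieszCoeff N κ a * q ^ (1 - (N : ℝ)⁻¹) * P ^ (1 / q)) := by
    have h1 := log_rpow_le hP1 hq hθ
    calc (N * κ * (Real.log P / a)) ^ (1 - (N : ℝ)⁻¹)
        = (N * κ / a) ^ (1 - (N : ℝ)⁻¹) * Real.log P ^ (1 - (N : ℝ)⁻¹) := by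
          rw [← mul_rpow (by positivity) hlogP]
          congr 1
          ring
      _ ≤ (N * κ / a) ^ (1 - (N : ℝ)⁻¹) *
          ((q * (1 - (N : ℝ)⁻¹) / Real.exp 1) ^ (1 - (N : ℝ)⁻¹) * P ^ (1 / q)) := by gcongr
      _ = _ := by
          unfold rieszCoeff
          rw [mul_rpow (by positivity : 0 ≤ N * κ / a) (by positivity),
            show q * (1 - (N : ℝ)⁻¹) / Real.exp 1 = ((1 - (N : ℝ)⁻¹) / Real.exp 1) * q by ring,
            mul_rpow (x := (1 - (N : ℝ)⁻¹) / Real.exp 1) (by positivity) hq.le]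
          field_simp
  have hPq : 1 ≤ P ^ (1 / q) := one_le_rpow hP1 (by positivity)
  have hmain : t ≤ (rieszRemainder N κ a + rieszCoeff N κ a * q ^ (1 - (N : ℝ)⁻¹)) * P ^ (1 / q) := by
    have h1 : 0 < N * κ := by positivity
    refine le_of_mul_le_mul_left ?_ h1
    nlinarith [mul_le_mul_of_nonneg_left hPq (mul_pos h1 hc0).le]
  have hfin : 1 + ENNReal.ofReal (R ^ a) * G = ENNReal.ofReal P := by
    rw [hGg, ← ENNReal.ofReal_mul hRa.le, hP, ENNReal.ofReal_add zero_le_one (by positivity),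
      ENNReal.ofReal_one]
  rw [hfin, ← ENNReal.ofReal_mul (by positivity)]
  refine ENNReal.ofReal_le_ofReal ((rpow_le_rpow ht hmain hq.le).trans (le_of_eq ?_))
  rw [mul_rpow (by positivity) (by positivity), ← rpow_mul hP0.le, one_div,
    inv_mul_cancel₀ hq.ne', rpow_one]

lemma gradient_eq_zero_of_notMem_tsupport {N : ℕ} {u : Euc N → ℝ} {x : Euc N}
    (hx : x ∉ tsupport u) : gradient u x = 0 := by
  have : fderiv ℝ u x = 0 := by
    by_contra h
    exact hx (support_fderiv_subset ℝ h)
  simp [gradient, this]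

lemma hasCompactSupport_comp_gradient {N : ℕ} {H : Euc N → ℝ} (hH : IsFinslerNorm N H)
    (hN : N ≠ 0) {u : Euc N → ℝ} (hc : HasCompactSupport u) :
    HasCompactSupport fun y => H (gradient u y) ^ N :=
  HasCompactSupport.intro hc fun y hy => by
    simp [gradient_eq_zero_of_notMem_tsupport hy, hH.map_zero, hN]

lemma IsFinslerNorm.exists_diam_bound {N : ℕ} {F : Euc N → ℝ} (hF : IsFinslerNorm N F)
    {Ω : Set (Euc N)} (hΩb : Bornology.IsBounded Ω) :
    ∃ R, 0 < R ∧ ∀ x ∈ Ω, ∀ y ∈ Ω, F (y - x) < R := by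
  obtain ⟨C, hC, hle⟩ := hF.exists_le_norm
  obtain ⟨B, hB⟩ := hΩb.exists_norm_le
  refine ⟨C * (2 * |B|) + 1, by positivity, fun x hx y hy => ?_⟩
  have h1 : ‖y - x‖ ≤ 2 * |B| := by
    have := norm_sub_le y x
    have := hB x hx
    have := hB y hy
    linarith [le_abs_self B]
  have := mul_le_mul_of_nonneg_left h1 hC.le
  linarith [hle (y - x)]

lemma lintegral_riesz_kernel_le {N : ℕ} [Nontrivial (Euc N)] {F : Euc N → ℝ}
    (hF : IsFinslerNorm N F) {Ω : Set (Euc N)} {R a : ℝ} (hR : 0 < R) (ha : a < N)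
    (hΩR : ∀ x ∈ Ω, ∀ y ∈ Ω, F (y - x) < R) {g : Euc N → ℝ} (hgc : Continuous g)
    (hg0 : ∀ y, 0 ≤ g y) (hgΩ : ∀ y, y ∉ Ω → g y = 0) (hg1 : ∫⁻ y, ENNReal.ofReal (g y) ≤ 1) :
    ∫⁻ x in Ω, ∫⁻ y, ENNReal.ofReal (g (x + y) * F y ^ (-a)) ≤
      ENNReal.ofReal (N * unitVol F / (N - a) * R ^ (N - a)) := by
  have hFc := hF.continuous
  calc ∫⁻ x in Ω, ∫⁻ y, ENNReal.ofReal (g (x + y) * F y ^ (-a))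
      = ∫⁻ x in Ω, ∫⁻ y, ENNReal.ofReal (g y * F (y - x) ^ (-a)) := by
        congr 1
        ext x
        rw [← lintegral_add_left_eq_self (fun y => ENNReal.ofReal (g y * F (y - x) ^ (-a))) x]
        simp_rw [add_sub_cancel_left]
    _ = ∫⁻ y, ∫⁻ x in Ω, ENNReal.ofReal (g y * F (y - x) ^ (-a)) := by
        refine lintegral_lintegral_swap (Measurable.aemeasurable ?_)
        unfold Function.uncurry
        fun_prop
    _ ≤ ∫⁻ y, ENNReal.ofReal (g y) * ENNReal.ofReal (N * unitVol F / (N - a) * R ^ (N - a)) := by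
        refine lintegral_mono fun y => ?_
        by_cases hy : y ∈ Ω
        · have hm : MeasurableSet {z | F z ∈ Iio R} := hFc.measurable measurableSet_Iio
          simp_rw [ENNReal.ofReal_mul (hg0 y)]
          rw [lintegral_const_mul _ (by fun_prop)]
          gcongr
          rw [← hF.lintegral_ball_rpow ha hR.le,
            ← lintegral_indicator hm,
            ← lintegral_sub_left_eq_self
              ({z | F z ∈ Iio R}.indicator fun z => ENNReal.ofReal (F z ^ (-a))) y]
          refine (lintegral_mono_set fun x hx => ?_ : _ ≤ ∫⁻ x in {x | F (y - x) < R},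
            ENNReal.ofReal (F (y - x) ^ (-a))).trans (le_of_eq ?_)
          · exact hΩR x hx y hy
          · rw [← lintegral_indicator]
            · rfl
            · exact measurableSet_lt (by fun_prop) (by fun_prop)
        · simp [hgΩ y hy]
    _ ≤ 1 * ENNReal.ofReal (N * unitVol F / (N - a) * R ^ (N - a)) := by
        rw [lintegral_mul_const _ (by fun_prop)]
        gcongr
    _ = _ := one_mul _

lemma exists_lintegral_rpow_le {N : ℕ} (hN : 2 ≤ N) {H : Euc N → ℝ} (hH : IsFinslerNorm N H)
    {Ω : Set (Euc N)} (hΩo : IsOpen Ω) (hΩb : Bornology.IsBounded Ω) {a : ℝ} (ha : 0 < a)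
    (haN : a < N) :
    ∃ M : ℝ, 0 < M ∧ ∀ q > 0, ∀ u : Euc N → ℝ, ContDiff ℝ 1 u → HasCompactSupport u →
      tsupport u ⊆ Ω → ∫⁻ y, ENNReal.ofReal (H (gradient u y) ^ N) ≤ 1 →
      ∫⁻ x in Ω, ENNReal.ofReal (|u x| ^ q) ≤ ENNReal.ofReal
        ((rieszRemainder N (wulffVol N H) a
          + rieszCoeff N (wulffVol N H) a * q ^ (1 - (N : ℝ)⁻¹)) ^ q * M) := by
  have := nontrivial_euc hN
  have hF := hH.dual
  have hκ := hF.unitVol_pos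
  have hNa : 0 < (N : ℝ) - a := by linarith
  have hN0 : (0 : ℝ) < N := by linarith
  have hN1 : (0 : ℝ) < N - 1 := by
    have : (2 : ℝ) ≤ N := by exact_mod_cast hN
    linarith
  have hθ := one_sub_inv_pos hN
  obtain ⟨R, hR, hΩR⟩ := hF.exists_diam_bound hΩb
  have hvol : volume Ω ≠ ⊤ := hΩb.measure_lt_top.ne
  refine ⟨(volume Ω).toReal + R ^ a * (N * unitVol (dualNorm H) / (N - a) * R ^ (N - a)),
    by positivity, fun q hq u hu hc hts h1 => ?_⟩
  change _ ≤ ENNReal.ofReal ((rieszRemainder N (unitVol (dualNorm H)) a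
          + rieszCoeff N (unitVol (dualNorm H)) a * q ^ (1 - (N : ℝ)⁻¹)) ^ q * _)
  set F := dualNorm H
  set κ := unitVol F
  have hc0 : 0 < rieszRemainder N κ a := by unfold rieszRemainder; positivity
  have hB0 : 0 < rieszCoeff N κ a := by unfold rieszCoeff; positivity
  have hgc := continuous_gradient hu
  have hHc := hH.continuous
  have hFc := hF.continuous
  have hf : ∀ y, y ∉ Ω → H (gradient u y) = 0 := fun y hy => by
    rw [gradient_eq_zero_of_notMem_tsupport fun h => hy (hts h), hH.map_zero]
  have hpt : ∀ x ∈ Ω, ENNReal.ofReal (|u x| ^ q) ≤ ENNReal.ofReal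
      ((rieszRemainder N κ a + rieszCoeff N κ a * q ^ (1 - (N : ℝ)⁻¹)) ^ q) *
      (1 + ENNReal.ofReal (R ^ a) *
        ∫⁻ y, ENNReal.ofReal (H (gradient u (x + y)) ^ N * F y ^ (-a))) := by
    intro x hx
    refine pointwise_bound hN hF (f := fun y => H (gradient u (x + y))) (by fun_prop)
      (fun y => hH.nonneg _) hR ha hq (fun y hy => hf _ fun hxy => ?_) ?_ (abs_nonneg _)
      (ofReal_abs_le_riesz hH hu hc x)
    · have := hΩR x hx _ hxy
      rw [add_sub_cancel_left] at this
      linarith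
    · rwa [lintegral_add_left_eq_self (fun y => ENNReal.ofReal (H (gradient u y) ^ N)) x]
  have hmeas : Measurable fun x => ∫⁻ y, ENNReal.ofReal (H (gradient u (x + y)) ^ N * F y ^ (-a)) := by
    refine Measurable.lintegral_prod_right' (f := fun z : Euc N × Euc N =>
      ENNReal.ofReal (H (gradient u (z.1 + z.2)) ^ N * F z.2 ^ (-a))) ?_
    fun_prop
  calc ∫⁻ x in Ω, ENNReal.ofReal (|u x| ^ q)
      ≤ ∫⁻ x in Ω, ENNReal.ofReal
        ((rieszRemainder N κ a + rieszCoeff N κ a * q ^ (1 - (N : ℝ)⁻¹)) ^ q) *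
        (1 + ENNReal.ofReal (R ^ a) *
          ∫⁻ y, ENNReal.ofReal (H (gradient u (x + y)) ^ N * F y ^ (-a))) :=
        setLIntegral_mono' hΩo.measurableSet hpt
    _ = ENNReal.ofReal ((rieszRemainder N κ a + rieszCoeff N κ a * q ^ (1 - (N : ℝ)⁻¹)) ^ q) *
        (volume Ω + ENNReal.ofReal (R ^ a) *
          ∫⁻ x in Ω, ∫⁻ y, ENNReal.ofReal (H (gradient u (x + y)) ^ N * F y ^ (-a))) := by
        rw [lintegral_const_mul _ (by fun_prop), lintegral_add_left (by fun_prop),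
          lintegral_const_mul _ hmeas, setLIntegral_one]
    _ ≤ ENNReal.ofReal ((rieszRemainder N κ a + rieszCoeff N κ a * q ^ (1 - (N : ℝ)⁻¹)) ^ q) *
        (volume Ω + ENNReal.ofReal (R ^ a) *
          ENNReal.ofReal (N * κ / (N - a) * R ^ (N - a))) := by
        gcongr
        exact lintegral_riesz_kernel_le hF hR haN hΩR (g := fun y => H (gradient u y) ^ N)
          (by fun_prop) (fun y => pow_nonneg (hH.nonneg _) _)
          (fun y hy => by rw [hf y hy, zero_pow (by omega)]) h1
    _ = _ := by
        nth_rw 1 [← ENNReal.ofReal_toReal hvol]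
        rw [← ENNReal.ofReal_mul (by positivity), ← ENNReal.ofReal_add (by positivity) (by positivity),
          ← ENNReal.ofReal_mul (by positivity)]

/-- A quantitative lower bound on the energy of normalized test functions. -/
lemma exists_energy_lower_bound {N : ℕ} (hN : 2 ≤ N) {H : Euc N → ℝ} (hH : IsFinslerNorm N H)
    {Ω : Set (Euc N)} (hΩo : IsOpen Ω) (hΩb : Bornology.IsBounded Ω) {a : ℝ} (ha : 0 < a)
    (haN : a < N) :
    ∃ M : ℝ, 0 < M ∧ ∀ q > 1, ∀ u : Euc N → ℝ, ContDiff ℝ 1 u → HasCompactSupport u →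
      tsupport u ⊆ Ω → (∫ x in Ω, |u x| ^ q) = 1 →
      (rieszRemainder N (wulffVol N H) a
          + rieszCoeff N (wulffVol N H) a * q ^ (1 - (N : ℝ)⁻¹)) ^ (-(N : ℝ)) * M ^ (-(N : ℝ) / q)
        ≤ ∫ x in Ω, H (gradient u x) ^ N := by
  have := nontrivial_euc hN
  have hF := hH.dual
  have hκ : 0 < wulffVol N H := hF.unitVol_pos
  have hN1 : (0 : ℝ) < N - 1 := by
    have : (2 : ℝ) ≤ N := by exact_mod_cast hN
    linarith
  have hN0 : (0 : ℝ) < N := by linarith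
  have hθ := one_sub_inv_pos hN
  obtain ⟨M, hM, hb⟩ := exists_lintegral_rpow_le hN hH hΩo hΩb ha haN
  refine ⟨M, hM, fun q hq u hu hc hts h1 => ?_⟩
  have hq0 : 0 < q := by linarith
  set κ := wulffVol N H
  have hc0 : 0 < rieszRemainder N κ a := by unfold rieszRemainder; positivity
  have hB0 : 0 < rieszCoeff N κ a := by unfold rieszCoeff; positivity
  set K := rieszRemainder N κ a + rieszCoeff N κ a * q ^ (1 - (N : ℝ)⁻¹) with hK
  have hK0 : 0 < K := by positivity
  set b := K ^ (-(N : ℝ)) * M ^ (-(N : ℝ) / q) with hbdef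
  have hb0 : 0 < b := by positivity
  have hgc := continuous_gradient hu
  have hHc := hH.continuous
  by_contra! hlt
  set E := ∫ x in Ω, H (gradient u x) ^ N with hE
  have hE0 : 0 ≤ E := integral_nonneg fun x => pow_nonneg (hH.nonneg _) _
  obtain ⟨s, hEs, hsb⟩ := exists_between hlt
  have hs : 0 < s := hE0.trans_lt hEs
  set t := s ^ (1 / (N : ℝ)) with ht
  have ht0 : 0 < t := by positivity
  have htN : t ^ N = s := by
    rw [ht, ← rpow_natCast, ← rpow_mul hs.le, one_div, inv_mul_cancel₀ hN0.ne', rpow_one]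
  have hEu : ∫⁻ y, ENNReal.ofReal (H (gradient u y) ^ N) = ENNReal.ofReal E := by
    have hint : Integrable fun y => H (gradient u y) ^ N :=
      Continuous.integrable_of_hasCompactSupport (by fun_prop)
        (hasCompactSupport_comp_gradient hH (by omega) hc)
    rw [hE, setIntegral_eq_integral_of_forall_compl_eq_zero,
      ofReal_integral_eq_lintegral_ofReal hint
        (Eventually.of_forall fun y => pow_nonneg (hH.nonneg _) _)]
    intro y hy
    rw [gradient_eq_zero_of_notMem_tsupport fun h => hy (hts h), hH.map_zero, zero_pow (by omega)]
  have hgrad : ∀ y, gradient (fun x => t⁻¹ * u x) y = t⁻¹ • gradient u y := fun y => by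
    simp only [gradient]
    rw [fderiv_const_mul (hu.differentiable (by norm_num) y), _root_.map_smul]
  have hv1 : ∫⁻ y, ENNReal.ofReal (H (gradient (fun x => t⁻¹ * u x) y) ^ N) ≤ 1 := by
    have h2 : ∀ y, ENNReal.ofReal (H (gradient (fun x => t⁻¹ * u x) y) ^ N)
        = ENNReal.ofReal s⁻¹ * ENNReal.ofReal (H (gradient u y) ^ N) := fun y => by
      rw [hgrad, hH.map_smul_of_nonneg (by positivity), mul_pow, inv_pow, htN,
        ENNReal.ofReal_mul (by positivity)]
    simp_rw [h2]
    rw [lintegral_const_mul _ (by fun_prop), hEu, ← ENNReal.ofReal_mul (by positivity),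
      ENNReal.ofReal_le_one, inv_mul_le_iff₀ hs, mul_one]
    exact hEs.le
  have hsupp : tsupport (fun x => t⁻¹ * u x) ⊆ tsupport u :=
    closure_mono fun x hx => by
      simp only [Function.mem_support, ne_eq, mul_eq_zero, not_or] at hx
      exact hx.2
  have hres := hb q hq0 (fun x => t⁻¹ * u x) (contDiff_const.mul hu) hc.mul_left
    (hsupp.trans hts) hv1
  have hLq : ∫⁻ x in Ω, ENNReal.ofReal (|t⁻¹ * u x| ^ q) = ENNReal.ofReal (t ^ (-q)) := by
    have hint : IntegrableOn (fun x => |u x| ^ q) Ω := by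
      by_contra hni
      rw [integral_undef hni] at h1
      exact zero_ne_one h1
    have h2 : ∀ x, ENNReal.ofReal (|t⁻¹ * u x| ^ q)
        = ENNReal.ofReal (t ^ (-q)) * ENNReal.ofReal (|u x| ^ q) := fun x => by
      rw [abs_mul, abs_of_pos (inv_pos.2 ht0), mul_rpow (by positivity) (abs_nonneg _),
        inv_rpow ht0.le, ← rpow_neg ht0.le, ENNReal.ofReal_mul (by positivity)]
    have huc := hu.continuous
    simp_rw [h2]
    rw [lintegral_const_mul _ (by fun_prop), ← ofReal_integral_eq_lintegral_ofReal hint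
      (Eventually.of_forall fun y => by positivity), h1, ENNReal.ofReal_one, mul_one]
  rw [hLq, ENNReal.ofReal_le_ofReal_iff (by positivity)] at hres
  have h3 : t ^ (-q) = s ^ (-q / N) := by
    rw [ht, ← rpow_mul hs.le]
    congr 1
    ring
  have h4 : K ^ q * M = b ^ (-q / N) := by
    rw [hbdef, mul_rpow (by positivity) (by positivity), ← rpow_mul hK0.le, ← rpow_mul hM.le]
    have e1 : -(N : ℝ) * (-q / N) = q := by field_simp
    have e2 : -(N : ℝ) / q * (-q / N) = 1 := by field_simp
    rw [e1, e2, rpow_one]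
  rw [h3, h4] at hres
  have h5 : b ^ (-q / N) < s ^ (-q / N) :=
    rpow_lt_rpow_of_neg hs hsb (div_neg_of_neg_of_pos (by linarith) hN0)
  linarith

/-! ### Smooth Moser functions -/

/-- The truncated logarithmic profile: `L` near the origin, `0` beyond `R`. -/
def moserProfile (δ R s : ℝ) : ℝ := Real.log (R / max δ (min s R))

lemma continuous_moserProfile {δ R : ℝ} (hδ : 0 < δ) (hR : 0 < R) :
    Continuous (moserProfile δ R) := by
  have h : ∀ s, 0 < max δ (min s R) := fun s => hδ.trans_le (le_max_left _ _)
  unfold moserProfile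
  refine Continuous.log (continuous_const.div (by fun_prop) fun s => (h s).ne') fun s => ?_
  have := h s
  positivity

lemma moserProfile_of_le {δ R s : ℝ} (h : s ≤ δ) :
    moserProfile δ R s = Real.log (R / δ) := by
  rw [moserProfile, max_eq_left ((min_le_left _ _).trans h)]

lemma moserProfile_of_ge {δ R s : ℝ} (hδ : 0 < δ) (hδR : δ ≤ R) (h : R ≤ s) :
    moserProfile δ R s = 0 := by
  rw [moserProfile, min_eq_right h, max_eq_right hδR, div_self (hδ.trans_le hδR).ne', Real.log_one]

lemma moserProfile_sub_le {δ R ρ a b : ℝ} (hδ : 0 < δ) (hδR : δ ≤ R) (hρ : 0 < ρ) (hb : ρ ≤ b) :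
    moserProfile δ R b - moserProfile δ R a ≤ |a - b| / ρ := by
  have hR := hδ.trans_le hδR
  have hpos : ∀ s, 0 < max δ (min s R) := fun s => hδ.trans_le (le_max_left _ _)
  have ha' := hpos a
  have hb' := hpos b
  unfold moserProfile
  rw [Real.log_div hR.ne' hb'.ne', Real.log_div hR.ne' ha'.ne']
  rcases le_total R b with hRb | hbR
  · have h1 : Real.log (max δ (min a R)) ≤ Real.log (max δ (min b R)) := by
      refine Real.log_le_log ha' ?_
      rw [min_eq_right hRb, max_eq_right hδR]
      exact max_le hδR (min_le_right _ _)
    have : 0 ≤ |a - b| / ρ := by positivity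
    linarith
  · have h1 := Real.log_le_sub_one_of_pos (div_pos ha' hb')
    rw [Real.log_div ha'.ne' hb'.ne', div_sub_one hb'.ne'] at h1
    have h2 : max δ (min a R) - max δ (min b R) ≤ |a - b| :=
      (le_abs_self _).trans ((abs_max_sub_max_le_max _ _ _ _).trans (max_le (by simp)
        ((abs_min_sub_min_le_max _ _ _ _).trans (max_le le_rfl (by simp)))))
    have h3 : ρ ≤ max δ (min b R) := by
      rw [min_eq_left hbR]
      exact hb.trans (le_max_right _ _)
    have h4 : (max δ (min a R) - max δ (min b R)) / max δ (min b R) ≤ |a - b| / ρ := by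
      gcongr
    linarith

lemma inner_gradient_le_of_eventually {N : ℕ} {F f : Euc N → ℝ} (hF : IsFinslerNorm N F)
    {x : Euc N} {c : ℝ} (hf : DifferentiableAt ℝ f x)
    (h : ∀ᶠ y in 𝓝 x, f y - f x ≤ c * F (y - x)) (v : Euc N) : ⟪gradient f x, v⟫ ≤ c * F v := by
  have h1 : ⟪gradient f x, v⟫ = fderiv ℝ f x v := by simp [gradient]
  have h2 := hf.hasFDerivAt.hasLineDerivAt v
  have h3 := (HasDerivAt.tendsto_slope_zero_right h2)
  rw [h1]
  refine le_of_tendsto h3 ?_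
  have ht : Tendsto (fun t : ℝ => x + t • v) (𝓝[>] 0) (𝓝 x) := by
    have : Tendsto (fun t : ℝ => x + t • v) (𝓝 0) (𝓝 (x + (0 : ℝ) • v)) :=
      Continuous.tendsto (by fun_prop) 0
    rw [zero_smul, add_zero] at this
    exact this.mono_left nhdsWithin_le_nhds
  filter_upwards [ht.eventually h, self_mem_nhdsWithin] with t hle ht0
  have ht0' : (0 : ℝ) < t := ht0
  rw [add_sub_cancel_left, hF.map_smul_of_nonneg ht0'.le] at hle
  simp only [zero_add, zero_smul, add_zero, smul_eq_mul]
  rw [inv_mul_le_iff₀ ht0']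
  linarith

lemma normed_convolution_sub_le {N : ℕ} (φ : ContDiffBump (0 : Euc N)) {w : Euc N → ℝ}
    (hw : Continuous w) {x y : Euc N} {c : ℝ}
    (h : ∀ t ∈ Metric.ball (0 : Euc N) φ.rOut, w (y - t) - w (x - t) ≤ c) :
    (convolution (φ.normed volume) w (ContinuousLinearMap.lsmul ℝ ℝ) volume) y
      - (convolution (φ.normed volume) w (ContinuousLinearMap.lsmul ℝ ℝ) volume) x ≤ c := by
  have hint : ∀ z, Integrable fun t => φ.normed volume t * w (z - t) := fun z =>
    Continuous.integrable_of_hasCompactSupport (φ.continuous_normed.mul (by fun_prop))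
      φ.hasCompactSupport_normed.mul_right
  simp only [convolution_def, ContinuousLinearMap.lsmul_apply, smul_eq_mul]
  rw [← integral_sub (hint y) (hint x)]
  calc ∫ t, (φ.normed volume t * w (y - t) - φ.normed volume t * w (x - t))
      ≤ ∫ t, φ.normed volume t * c := by
        refine integral_mono ((hint y).sub (hint x)) (φ.integrable_normed.mul_const c) fun t => ?_
        simp only
        rw [← mul_sub]
        by_cases ht : t ∈ Metric.ball (0 : Euc N) φ.rOut
        · exact mul_le_mul_of_nonneg_left (h t ht) (φ.nonneg_normed t)
        · rw [← φ.support_normed_eq (μ := volume), Function.notMem_support] at ht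
          simp [ht]
    _ = c := by rw [integral_mul_const, φ.integral_normed, one_mul]

/-- Mollified Moser functions on a Wulff ball. -/
lemma exists_moser {N : ℕ} [Nontrivial (Euc N)] {H : Euc N → ℝ} (hH : IsFinslerNorm N H)
    (hr : FinslerRegular N H) (x₀ : Euc N) {δ R τ : ℝ} (hδ : 0 < δ) (hδR : δ ≤ R) (hτ : 0 < τ)
    (hτ2 : τ < 1 / 2) :
    ∃ v : Euc N → ℝ, ContDiff ℝ (⊤ : ℕ∞) v ∧
      (∀ x, R * (1 + τ) ≤ dualNorm H (x - x₀) → v x = 0) ∧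
      (∀ x, dualNorm H (x - x₀) < δ * (1 - τ) → v x = Real.log (R / δ)) ∧
      (∫⁻ x, ENNReal.ofReal (H (gradient v x) ^ N)) ≤ ENNReal.ofReal
        (((1 - τ) ^ N)⁻¹ * (N * unitVol (dualNorm H)
          * Real.log (R * (1 + τ) / (δ * (1 - τ))))) := by
  have hF := hH.dual
  have hN : N ≠ 0 := by
    rintro rfl
    exact not_subsingleton (Euc 0) inferInstance
  set F := dualNorm H with hFdef
  have hR := hδ.trans_le hδR
  have hFc := hF.continuous
  set η := τ * δ / 2 with hη
  have hη0 : 0 < η := by positivity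
  have hηδ : η < δ / 2 := by nlinarith
  have hηR : η < R * τ := by nlinarith
  have hηδτ : η < δ * τ := by nlinarith
  obtain ⟨C, hC, hFC⟩ := hF.exists_le_norm
  let φ : ContDiffBump (0 : Euc N) := ⟨η / (4 * C), η / (2 * C), by positivity, by
    apply div_lt_div_of_pos_left hη0 (by positivity); linarith⟩
  have hφ : ∀ t ∈ Metric.ball (0 : Euc N) φ.rOut, F t < η := fun t ht => by
    rw [mem_ball_zero_iff] at ht
    have h1 : ‖t‖ < η / (2 * C) := ht
    rw [lt_div_iff₀ (by positivity)] at h1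
    have := hFC t
    have := norm_nonneg t
    nlinarith
  have hφ' : ∀ x, ∀ y ∈ Metric.ball x φ.rOut, |F (y - x₀) - F (x - x₀)| < η := fun x y hy => by
    refine (hF.abs_sub_le _ _).trans_lt ?_
    rw [sub_sub_sub_cancel_right]
    apply hφ
    rwa [mem_ball_zero_iff, ← dist_eq_norm]
  set w : Euc N → ℝ := fun x => moserProfile δ R (F (x - x₀)) with hw
  have hwc : Continuous w := (continuous_moserProfile hδ hR).comp (by fun_prop)
  set v := convolution (φ.normed volume) w (ContinuousLinearMap.lsmul ℝ ℝ) volume with hv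
  have hvs : ContDiff ℝ (⊤ : ℕ∞) v :=
    HasCompactSupport.contDiff_convolution_left _ φ.hasCompactSupport_normed φ.contDiff_normed
      hwc.locallyIntegrable
  have hin : ∀ x, F (x - x₀) < δ - η → v x = Real.log (R / δ) := fun x hx => by
    have h1 : ∀ y ∈ Metric.ball x φ.rOut, w y = Real.log (R / δ) := fun y hy => by
      have := (abs_lt.1 (hφ' x y hy)).2
      exact moserProfile_of_le (by linarith)
    rw [hv, φ.normed_convolution_eq_right fun y hy => (h1 y hy).trans
      (h1 x (Metric.mem_ball_self φ.rOut_pos)).symm]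
    exact h1 x (Metric.mem_ball_self φ.rOut_pos)
  have hout : ∀ x, R + η < F (x - x₀) → v x = 0 := fun x hx => by
    have h1 : ∀ y ∈ Metric.ball x φ.rOut, w y = 0 := fun y hy => by
      have := (abs_lt.1 (hφ' x y hy)).1
      exact moserProfile_of_ge hδ hδR (by linarith)
    rw [hv, φ.normed_convolution_eq_right fun y hy => (h1 y hy).trans
      (h1 x (Metric.mem_ball_self φ.rOut_pos)).symm]
    exact h1 x (Metric.mem_ball_self φ.rOut_pos)
  have hconst : ∀ (c : ℝ) (x : Euc N), (∀ᶠ y in 𝓝 x, v y = c) → H (gradient v x) = 0 :=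
    fun c x h => by
      have : fderiv ℝ v x = 0 := by
        rw [Filter.EventuallyEq.fderiv_eq (f := fun _ => c) h, fderiv_const_apply]
      simp [gradient, this, hH.map_zero]
  have hgin : ∀ x, F (x - x₀) < δ - η → H (gradient v x) = 0 := fun x hx => by
    refine hconst (Real.log (R / δ)) x ?_
    filter_upwards [(isOpen_lt (by fun_prop : Continuous fun y => F (y - x₀))
      continuous_const).mem_nhds hx] with y hy using hin y hy
  have hgout : ∀ x, R + η < F (x - x₀) → H (gradient v x) = 0 := fun x hx => by
    refine hconst 0 x ?_
    filter_upwards [(isOpen_lt continuous_const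
      (by fun_prop : Continuous fun y => F (y - x₀))).mem_nhds hx] with y hy using hout y hy
  have hgmid : ∀ x, η < F (x - x₀) → H (gradient v x) ≤ (F (x - x₀) - η)⁻¹ := fun x hx => by
    refine hH.le_of_forall_inner_le hr (inv_nonneg.2 (by linarith)) fun z => ?_
    have hρ : ∀ᶠ ρ in 𝓝[<] (F (x - x₀) - η), ⟪gradient v x, z⟫ ≤ ρ⁻¹ * F z := by
      have hpos : 0 < F (x - x₀) - η := by linarith
      filter_upwards [Ioo_mem_nhdsLT hpos] with ρ hρ
      refine inner_gradient_le_of_eventually hF (hvs.differentiable (by simp) x) ?_ z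
      have ho : ∀ᶠ y in 𝓝 x, ρ + η < F (y - x₀) :=
        (isOpen_lt continuous_const (by fun_prop : Continuous fun y => F (y - x₀))).mem_nhds
          (by simp only [mem_ofPred_eq]; linarith [hρ.2])
      filter_upwards [ho] with y hy
      refine normed_convolution_sub_le φ hwc fun t ht => ?_
      have h1 := hφ t ht
      have h2 : ρ ≤ F (y - t - x₀) := by
        have := hF.sub_le (y - x₀) t
        rw [sub_right_comm] at this
        linarith
      refine (moserProfile_sub_le hδ hδR hρ.1 h2).trans ?_
      rw [div_eq_inv_mul]
      refine mul_le_mul_of_nonneg_left ?_ (inv_nonneg.2 hρ.1.le)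
      refine (hF.abs_sub_le _ _).trans (le_of_eq ?_)
      rw [← hF.map_neg]
      congr 1
      abel
    refine ge_of_tendsto (f := fun ρ : ℝ => ρ⁻¹ * F z) ?_ hρ
    refine ((tendsto_inv₀ (by linarith)).mul_const _).mono_left nhdsWithin_le_nhds
  refine ⟨v, hvs, fun x hx => hout x (by linarith), fun x hx => hin x (by linarith), ?_⟩
  have hτ1 : 0 < 1 - τ := by linarith
  have hm : MeasurableSet {z | F z ∈ Ico (δ * (1 - τ)) (R * (1 + τ))} :=
    hFc.measurable measurableSet_Ico
  have hann := hF.lintegral_annulus (δ := δ * (1 - τ)) (R := R * (1 + τ)) (by positivity)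
    (by nlinarith)
  rw [ENNReal.ofReal_mul (by positivity), ← hann, ← lintegral_indicator hm,
    ← lintegral_sub_right_eq_self (indicator _ fun z => ENNReal.ofReal (F z ^ (-(N : ℝ)))) x₀,
    ← lintegral_const_mul']
  · refine lintegral_mono fun x => ?_
    by_cases hx : F (x - x₀) ∈ Ico (δ * (1 - τ)) (R * (1 + τ))
    · rw [indicator_of_mem (by exact hx), ← ENNReal.ofReal_mul (by positivity)]
      refine ENNReal.ofReal_le_ofReal ?_
      have h0 : δ / 2 < F (x - x₀) := lt_of_lt_of_le (by nlinarith) hx.1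
      have h1 : (1 - τ) * F (x - x₀) ≤ F (x - x₀) - η := by nlinarith
      have h2 : 0 < (1 - τ) * F (x - x₀) := mul_pos hτ1 (by linarith)
      rw [rpow_neg (hF.nonneg _), rpow_natCast, ← mul_inv, ← mul_pow, ← inv_pow]
      exact pow_le_pow_left₀ (hH.nonneg _) ((hgmid x (by linarith)).trans
        (inv_anti₀ h2 h1)) _
    · have h0 : H (gradient v x) = 0 := by
        rw [mem_Ico, not_and_or, not_le, not_lt] at hx
        rcases hx with hx | hx
        · exact hgin x (by linarith)
        · exact hgout x (by linarith)
      simp [h0, hN]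
  · exact ENNReal.ofReal_ne_top

/-! ### Upper bound for the infimum -/

lemma gradient_const_mul {N : ℕ} {v : Euc N → ℝ} (hv : Differentiable ℝ v) (t : ℝ) (x : Euc N) :
    gradient (fun y => t * v y) x = t • gradient v x := by
  simp only [gradient]
  rw [fderiv_const_mul (hv x), _root_.map_smul]

lemma bddBelow_energy {N : ℕ} {H : Euc N → ℝ} (hH : IsFinslerNorm N H) (Ω : Set (Euc N)) (p : ℝ) :
    BddBelow {c : ℝ | ∃ u : Euc N → ℝ, ContDiff ℝ (⊤ : ℕ∞) u ∧ HasCompactSupport u ∧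
      tsupport u ⊆ Ω ∧ (∫ x in Ω, |u x| ^ (p + 1)) = 1 ∧
      c = ∫ x in Ω, H (gradient u x) ^ N} := by
  refine ⟨0, ?_⟩
  rintro c ⟨u, -, -, -, -, rfl⟩
  exact integral_nonneg fun x => pow_nonneg (hH.nonneg _) _

lemma exists_normalized {N : ℕ} (hN : N ≠ 0) {H : Euc N → ℝ} (hH : IsFinslerNorm N H)
    {Ω : Set (Euc N)} {p : ℝ} (hp : 1 < p) {v : Euc N → ℝ} (hv : ContDiff ℝ (⊤ : ℕ∞) v)
    (hc : HasCompactSupport v) (hs : tsupport v ⊆ Ω) {E m : ℝ} (hE0 : 0 ≤ E)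
    (hE : (∫⁻ x, ENNReal.ofReal (H (gradient v x) ^ N)) ≤ ENNReal.ofReal E) (hm : 0 < m)
    (hmv : m ≤ ∫ x in Ω, |v x| ^ (p + 1)) :
    ∃ u : Euc N → ℝ, (ContDiff ℝ (⊤ : ℕ∞) u ∧ HasCompactSupport u ∧
      tsupport u ⊆ Ω ∧ (∫ x in Ω, |u x| ^ (p + 1)) = 1) ∧
      ∫ x in Ω, H (gradient u x) ^ N ≤ E / m ^ ((N : ℝ) / (p + 1)) := by
  have hq : 0 < p + 1 := by linarith
  set I := ∫ x in Ω, |v x| ^ (p + 1) with hI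
  have hI0 : 0 < I := hm.trans_le hmv
  set t := I ^ (-(1 / (p + 1))) with ht
  have ht0 : 0 < t := by positivity
  have hsupp : tsupport (fun x => t * v x) ⊆ tsupport v :=
    closure_mono fun x hx => by
      simp only [Function.mem_support, ne_eq, mul_eq_zero, not_or] at hx
      exact hx.2
  have hvc : ContDiff ℝ 1 v := hv.of_le (by simp)
  have hgc := continuous_gradient hvc
  have hHc := hH.continuous
  refine ⟨fun x => t * v x, ⟨contDiff_const.mul hv, hc.mul_left, hsupp.trans hs, ?_⟩, ?_⟩
  · simp_rw [abs_mul, abs_of_pos ht0]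
    simp_rw [mul_rpow ht0.le (abs_nonneg _)]
    rw [integral_const_mul, ← hI, ht, ← rpow_mul hI0.le]
    have : -(1 / (p + 1)) * (p + 1) = -1 := by field_simp
    rw [this, rpow_neg_one, inv_mul_cancel₀ hI0.ne']
  · simp_rw [gradient_const_mul (hvc.differentiable (by norm_num)), hH.map_smul_of_nonneg ht0.le,
      mul_pow]
    rw [integral_const_mul]
    have h1 : ∫ x in Ω, H (gradient v x) ^ N ≤ E := by
      rw [integral_eq_lintegral_of_nonneg_ae
        (Eventually.of_forall fun y => pow_nonneg (hH.nonneg _) _)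
        (Continuous.aestronglyMeasurable (by fun_prop))]
      exact ENNReal.toReal_le_of_le_ofReal hE0 ((setLIntegral_le_lintegral _ _).trans hE)
    have h2 : t ^ N ≤ (m ^ ((N : ℝ) / (p + 1)))⁻¹ := by
      rw [ht, ← rpow_natCast, ← rpow_mul hI0.le, ← rpow_neg hm.le]
      have : -(1 / (p + 1)) * (N : ℝ) = -((N : ℝ) / (p + 1)) := by ring
      rw [this]
      exact rpow_le_rpow_of_nonpos hm hmv (neg_nonpos.2 (by positivity))
    rw [div_eq_inv_mul]
    gcongr
    exact integral_nonneg fun x => pow_nonneg (hH.nonneg _) _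

lemma exists_normalized_moser {N : ℕ} [Nontrivial (Euc N)] {H : Euc N → ℝ}
    (hH : IsFinslerNorm N H) (hr : FinslerRegular N H) {Ω : Set (Euc N)} (hΩo : IsOpen Ω)
    (hΩne : Ω.Nonempty) :
    ∃ R : ℝ, 0 < R ∧ ∀ p > 1, ∀ L > 0, ∀ τ > 0, τ < 1 / 2 →
      ∃ u : Euc N → ℝ, (ContDiff ℝ (⊤ : ℕ∞) u ∧ HasCompactSupport u ∧
      tsupport u ⊆ Ω ∧ (∫ x in Ω, |u x| ^ (p + 1)) = 1) ∧
      ∫ x in Ω, H (gradient u x) ^ N ≤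
        (((1 - τ) ^ N)⁻¹ * (N * wulffVol N H * (L + Real.log ((1 + τ) / (1 - τ))))) /
          (L ^ (p + 1) * (wulffVol N H * (R * Real.exp (-L) * (1 - τ)) ^ N)) ^ ((N : ℝ) / (p + 1)) := by
  obtain ⟨x₀, hx₀⟩ := hΩne
  obtain ⟨r, hr0, hrΩ⟩ := Metric.isOpen_iff.1 hΩo x₀ hx₀
  have hF := hH.dual
  have hκ : 0 < wulffVol N H := hF.unitVol_pos
  have hFc := hF.continuous
  obtain ⟨C, hC, hFC⟩ := hF.exists_norm_le
  have hN : N ≠ 0 := by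
    rintro rfl
    exact not_subsingleton (Euc 0) inferInstance
  refine ⟨r / (2 * C), by positivity, fun p hp L hL τ hτ hτ2 => ?_⟩
  set R := r / (2 * C) with hR
  have hR0 : 0 < R := by positivity
  set δ := R * Real.exp (-L) with hδ
  have hδ0 : 0 < δ := by positivity
  have hδR : δ ≤ R := mul_le_of_le_one_right hR0.le (Real.exp_le_one_iff.2 (by linarith))
  have hτ1 : 0 < 1 - τ := by linarith
  have hlog : Real.log (R / δ) = L := by
    rw [hδ, ← div_div, div_self hR0.ne', Real.exp_neg, one_div, inv_inv, Real.log_exp]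
  have hlog2 : Real.log (R * (1 + τ) / (δ * (1 - τ))) = L + Real.log ((1 + τ) / (1 - τ)) := by
    rw [mul_div_mul_comm, Real.log_mul (by positivity) (by positivity), hlog]
  obtain ⟨v, hv, hout, hin, hE⟩ := exists_moser hH hr x₀ hδ0 hδR hτ hτ2
  rw [hlog] at hin
  rw [hlog2] at hE
  have hball : ∀ x, dualNorm H (x - x₀) < 3 / 2 * R → ‖x - x₀‖ ≤ 3 / 4 * r := fun x hx => by
    have h1 := (hFC (x - x₀)).trans (mul_le_mul_of_nonneg_left hx.le hC.le)
    have h2 : C * (3 / 2 * R) = 3 / 4 * r := by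
      rw [hR]
      field_simp
      norm_num
    rwa [h2] at h1
  have hsub : tsupport v ⊆ Metric.closedBall x₀ (3 / 4 * r) := by
    refine closure_minimal (fun x hx => ?_) Metric.isClosed_closedBall
    rw [mem_closedBall_iff_norm]
    refine hball x (lt_of_lt_of_le (lt_of_not_ge fun h => hx (hout x h)) (by nlinarith))
  have hvΩ : tsupport v ⊆ Ω :=
    (hsub.trans (Metric.closedBall_subset_ball (by linarith))).trans hrΩ
  have hvc : HasCompactSupport v :=
    HasCompactSupport.of_support_subset_isCompact (isCompact_closedBall x₀ (3 / 4 * r))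
      (subset_closure.trans hsub)
  have hlogτ : 0 ≤ Real.log ((1 + τ) / (1 - τ)) :=
    Real.log_nonneg ((one_le_div hτ1).2 (by linarith))
  refine exists_normalized hN hH hp hv hvc hvΩ (by positivity) hE (by positivity) ?_
  have hq : 0 < p + 1 := by linarith
  set B := {x : Euc N | dualNorm H (x - x₀) < δ * (1 - τ)} with hB
  have hBo : IsOpen B := isOpen_lt (by fun_prop) continuous_const
  have hBΩ : B ⊆ Ω := fun x hx => by
    refine hrΩ (mem_ball_iff_norm.2 ((hball x ?_).trans_lt (by linarith)))
    have : δ * (1 - τ) ≤ R := by nlinarith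
    exact lt_of_lt_of_le hx (by linarith)
  have hBvol : volume B = ENNReal.ofReal (wulffVol N H * (δ * (1 - τ)) ^ N) := by
    refine Eq.trans ?_ (hF.volume_ball (δ * (1 - τ)) (by positivity))
    have := measure_preimage_add_right (volume : Measure (Euc N)) (-x₀)
      {x | dualNorm H x < δ * (1 - τ)}
    simpa only [preimage_ofPred_eq, ← sub_eq_add_neg] using this
  have hvcont := hv.continuous
  have hint : IntegrableOn (fun x => |v x| ^ (p + 1)) Ω := by
    refine (Continuous.integrable_of_hasCompactSupport ?_ ?_).integrableOn
    · exact hvcont.abs.rpow_const fun x => Or.inr hq.le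
    · exact hvc.comp_left (g := fun s : ℝ => |s| ^ (p + 1)) (by simp [hq.ne'])
  calc L ^ (p + 1) * (wulffVol N H * (δ * (1 - τ)) ^ N)
      = ∫ x in B, |v x| ^ (p + 1) := by
        rw [setIntegral_congr_fun (g := fun _ => L ^ (p + 1)) hBo.measurableSet fun x hx => by
          simp only [hin x hx, abs_of_pos hL]]
        rw [setIntegral_const, measureReal_def, hBvol, ENNReal.toReal_ofReal (by positivity),
          smul_eq_mul, mul_comm]
    _ ≤ ∫ x in Ω, |v x| ^ (p + 1) :=
        setIntegral_mono_set hint (Eventually.of_forall fun x => by positivity)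
          hBΩ.eventuallyLE

/-! ### Asymptotics of the infimum -/

/-- The limit of `p ^ (N - 1) * C_p`. -/
def limitEnergy (N : ℕ) (κ : ℝ) : ℝ := N * κ * ((N : ℝ) ^ 2 * Real.exp 1 / (N - 1)) ^ (N - 1)

lemma one_lt_natCast {N : ℕ} (hN : 2 ≤ N) : (1 : ℝ) < N := by
  have : (2 : ℝ) ≤ N := by exact_mod_cast hN
  linarith

lemma limitEnergy_pos {N : ℕ} (hN : 2 ≤ N) {κ : ℝ} (hκ : 0 < κ) : 0 < limitEnergy N κ := by
  have := one_lt_natCast hN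
  have h1 : (0 : ℝ) < N - 1 := by linarith
  unfold limitEnergy
  positivity

lemma limitEnergy_eq {N : ℕ} (hN : 2 ≤ N) {H : Euc N → ℝ} (hκ : 0 < wulffVol N H) :
    limitEnergy N (wulffVol N H)
      = (N * Real.exp 1 / ((N : ℝ) - 1) * betaN N H) ^ (N - 1) := by
  have h1 := one_lt_natCast hN
  have hN1 : ((N - 1 : ℕ) : ℝ) = N - 1 := by
    rw [Nat.cast_sub (by omega), Nat.cast_one]
  have h2 : ((N * wulffVol N H) ^ ((1 : ℝ) / ((N : ℝ) - 1))) ^ (N - 1) = N * wulffVol N H := by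
    rw [← rpow_natCast, ← rpow_mul (by positivity), hN1, one_div,
      inv_mul_cancel₀ (by linarith), rpow_one]
  rw [limitEnergy, betaN, ← mul_assoc, mul_pow _ ((N * wulffVol N H) ^ _), h2, mul_comm]
  congr 2
  ring

lemma energyInf_le {N : ℕ} (hN : 2 ≤ N) {H : Euc N → ℝ} (hH : IsFinslerNorm N H)
    (hr : FinslerRegular N H) {Ω : Set (Euc N)} (hΩo : IsOpen Ω) (hΩne : Ω.Nonempty) :
    ∃ K : ℝ, 0 < K ∧ ∀ p > 1, (p + 1) ^ (N - 1) * energyInf N H Ω p ≤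
      limitEnergy N (wulffVol N H) * K ^ (-((N : ℝ) / (p + 1))) := by
  have := nontrivial_euc hN
  have hκ : 0 < wulffVol N H := hH.dual.unitVol_pos
  have hN1 := one_lt_natCast hN
  have hN0 : (0 : ℝ) < N - 1 := by linarith
  obtain ⟨R, hR, h⟩ := exists_normalized_moser hH hr hΩo hΩne
  set κ := wulffVol N H
  refine ⟨κ * R ^ N, by positivity, fun p hp => ?_⟩
  have hq : 0 < p + 1 := by linarith
  set q := p + 1
  set s : ℝ := (N - 1) / N ^ 2 with hs
  have hs0 : 0 < s := by positivity
  set L := q * s with hLdef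
  have hL : 0 < L := by positivity
  have hle : energyInf N H Ω p ≤
      N * κ * L / (L ^ q * (κ * (R * Real.exp (-L)) ^ N)) ^ ((N : ℝ) / q) := by
    have ht : Tendsto (fun τ : ℝ => (((1 - τ) ^ N)⁻¹ * (N * κ * (L + Real.log ((1 + τ) / (1 - τ))))) /
        (L ^ q * (κ * (R * Real.exp (-L) * (1 - τ)) ^ N)) ^ ((N : ℝ) / q)) (𝓝[>] 0)
        (𝓝 (N * κ * L / (L ^ q * (κ * (R * Real.exp (-L)) ^ N)) ^ ((N : ℝ) / q))) := by
      have hc : ContinuousAt (fun τ : ℝ => (((1 - τ) ^ N)⁻¹ *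
          (N * κ * (L + Real.log ((1 + τ) / (1 - τ))))) /
          (L ^ q * (κ * (R * Real.exp (-L) * (1 - τ)) ^ N)) ^ ((N : ℝ) / q)) 0 := by
        refine ContinuousAt.div ?_ ?_ ?_
        · refine ContinuousAt.mul (ContinuousAt.inv₀ (by fun_prop) (by simp)) ?_
          refine continuousAt_const.mul (continuousAt_const.add ?_)
          refine ContinuousAt.log (ContinuousAt.div (by fun_prop) (by fun_prop) (by simp)) (by simp)
        · refine ContinuousAt.rpow_const (by fun_prop) (Or.inr (by positivity))
        · rw [sub_zero, mul_one]
          positivity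
      have := hc.tendsto
      simp only [sub_zero, mul_one, add_zero, div_one, one_pow, inv_one, one_mul, Real.log_one] at this
      exact this.mono_left nhdsWithin_le_nhds
    refine ge_of_tendsto ht ?_
    filter_upwards [Ioo_mem_nhdsGT (by norm_num : (0 : ℝ) < 1 / 2)] with τ hτ
    obtain ⟨u, ⟨h1, h2, h3, h4⟩, h5⟩ := h p hp L hL τ hτ.1 hτ.2
    exact (csInf_le (bddBelow_energy hH Ω p) ⟨u, h1, h2, h3, h4, rfl⟩).trans h5
  refine (mul_le_mul_of_nonneg_left hle (by positivity)).trans (le_of_eq ?_)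
  have e1 : (L ^ q * (κ * (R * Real.exp (-L)) ^ N)) ^ ((N : ℝ) / q)
      = L ^ N * (κ * R ^ N) ^ ((N : ℝ) / q) * (Real.exp 1 ^ (N - 1))⁻¹ := by
    have a1 : κ * (R * Real.exp (-L)) ^ N = κ * R ^ N * Real.exp (-(N * L)) := by
      rw [mul_pow, ← Real.exp_nat_mul]
      ring_nf
    rw [a1, mul_rpow (x := L ^ q) (by positivity) (by positivity),
      mul_rpow (x := κ * R ^ N) (by positivity) (by positivity), ← rpow_mul hL.le, ← Real.exp_mul,
      ← Real.exp_nat_mul, ← Real.exp_neg, ← mul_assoc,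
      mul_div_cancel₀ _ hq.ne', rpow_natCast, Nat.cast_sub (by omega)]
    congr 2
    rw [hLdef, hs]
    field_simp
    simp
  rw [e1, rpow_neg (by positivity), limitEnergy]
  have e2 : (N : ℝ) ^ 2 * Real.exp 1 / (N - 1) = Real.exp 1 / s := by
    rw [hs]
    field_simp
  obtain ⟨n, rfl⟩ : ∃ n, N = n + 1 := ⟨N - 1, by omega⟩
  rw [e2, Nat.add_sub_cancel, div_pow, hLdef, mul_pow, pow_succ q, pow_succ s]
  field_simp

lemma le_energyInf {N : ℕ} (hN : 2 ≤ N) {H : Euc N → ℝ} (hH : IsFinslerNorm N H)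
    (hr : FinslerRegular N H) {Ω : Set (Euc N)} (hΩo : IsOpen Ω) (hΩb : Bornology.IsBounded Ω)
    (hΩne : Ω.Nonempty) {a : ℝ} (ha : 0 < a) (haN : a < N) :
    ∃ M : ℝ, 0 < M ∧ ∀ p > 1,
      (rieszRemainder N (wulffVol N H) a * (p + 1) ^ (-(1 - (N : ℝ)⁻¹))
        + rieszCoeff N (wulffVol N H) a) ^ (-(N : ℝ)) * M ^ (-(N : ℝ) / (p + 1))
        ≤ (p + 1) ^ (N - 1) * energyInf N H Ω p := by
  have := nontrivial_euc hN
  have hκ : 0 < wulffVol N H := hH.dual.unitVol_pos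
  have hN1 := one_lt_natCast hN
  have hN0 : (0 : ℝ) < N - 1 := by linarith
  have hθ := one_sub_inv_pos hN
  obtain ⟨R, hR, hmos⟩ := exists_normalized_moser hH hr hΩo hΩne
  obtain ⟨M, hM, h⟩ := exists_energy_lower_bound hN hH hΩo hΩb ha haN
  set κ := wulffVol N H
  have hc0 : 0 < rieszRemainder N κ a := by unfold rieszRemainder; positivity
  have hB0 : 0 < rieszCoeff N κ a := by unfold rieszCoeff; positivity
  refine ⟨M, hM, fun p hp => ?_⟩
  have hq : 0 < p + 1 := by linarith
  have h1 : (rieszRemainder N κ a + rieszCoeff N κ a * (p + 1) ^ (1 - (N : ℝ)⁻¹)) ^ (-(N : ℝ))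
      * M ^ (-(N : ℝ) / (p + 1)) ≤ energyInf N H Ω p := by
    refine le_csInf ?_ ?_
    · obtain ⟨u, ⟨h1, h2, h3, h4⟩, -⟩ := hmos p hp 1 one_pos (1 / 4) (by norm_num) (by norm_num)
      exact ⟨_, u, h1, h2, h3, h4, rfl⟩
    · rintro c ⟨u, hu, hc, hs, h1, rfl⟩
      exact h (p + 1) (by linarith) u (hu.of_le (by simp)) hc hs h1
  refine le_trans (le_of_eq ?_) (mul_le_mul_of_nonneg_left h1 (by positivity))
  rw [← mul_assoc]
  congr 1
  have e1 : (p + 1) ^ (N - 1) = ((p + 1) ^ (-(1 - (N : ℝ)⁻¹))) ^ (-(N : ℝ)) := by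
    rw [← rpow_mul hq.le, ← rpow_natCast, Nat.cast_sub (by omega)]
    congr 1
    field_simp
    simp
  rw [e1, ← mul_rpow (by positivity) (by positivity), mul_add, mul_left_comm, ← rpow_add hq,
    neg_add_cancel, rpow_zero, mul_one, mul_comm]

lemma rieszCoeff_rpow_dim {N : ℕ} (hN : 2 ≤ N) {κ : ℝ} (hκ : 0 < κ) :
    rieszCoeff N κ N ^ (-(N : ℝ)) = limitEnergy N κ := by
  have hN1 := one_lt_natCast hN
  have hN0 : (0 : ℝ) < N - 1 := by linarith
  have hθ := one_sub_inv_pos hN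
  rw [rieszCoeff, div_rpow (by positivity) (by positivity), ← rpow_mul (by positivity), limitEnergy]
  have e1 : (1 - (N : ℝ)⁻¹) * -(N : ℝ) = -((N - 1 : ℕ) : ℝ) := by
    rw [Nat.cast_sub (by omega)]
    field_simp
    simp
  rw [e1, rpow_neg (by positivity), rpow_neg (by positivity), rpow_natCast, rpow_natCast]
  have e2 : N * κ / N * ((1 - (N : ℝ)⁻¹) / Real.exp 1)
      = N * κ / ((N : ℝ) ^ 2 * Real.exp 1 / (N - 1)) := by
    field_simp
  rw [e2]
  obtain ⟨n, rfl⟩ : ∃ n, N = n + 1 := ⟨N - 1, by omega⟩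
  rw [Nat.add_sub_cancel, div_pow, pow_succ (((n + 1 : ℕ) : ℝ) * κ)]
  field_simp

lemma tendsto_rpow_neg_const_div {N : ℕ} {K : ℝ} (hK : 0 < K) :
    Tendsto (fun p : ℝ => K ^ (-((N : ℝ) / (p + 1)))) atTop (𝓝 1) := by
  have h1 : Tendsto (fun p : ℝ => -((N : ℝ) / (p + 1))) atTop (𝓝 (-0)) :=
    (tendsto_const_nhds.div_atTop (tendsto_atTop_add_const_right _ _ tendsto_id)).neg
  rw [neg_zero] at h1
  have := (Real.continuousAt_const_rpow hK.ne' (b := 0)).tendsto.comp h1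
  rwa [rpow_zero] at this

lemma tendsto_succ_pow_mul_energyInf {N : ℕ} (hN : 2 ≤ N) {H : Euc N → ℝ}
    (hH : IsFinslerNorm N H) (hr : FinslerRegular N H) {Ω : Set (Euc N)} (hΩo : IsOpen Ω)
    (hΩb : Bornology.IsBounded Ω) (hΩne : Ω.Nonempty) :
    Tendsto (fun p : ℝ => (p + 1) ^ (N - 1) * energyInf N H Ω p) atTop
      (𝓝 (limitEnergy N (wulffVol N H))) := by
  have := nontrivial_euc hN
  have hκ : 0 < wulffVol N H := hH.dual.unitVol_pos
  have hN1 := one_lt_natCast hN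
  have hN0 : (0 : ℝ) < N - 1 := by linarith
  have hθ := one_sub_inv_pos hN
  rw [tendsto_order]
  constructor
  · intro y hy
    rw [← rieszCoeff_rpow_dim hN hκ] at hy
    set κ := wulffVol N H
    have hB0 : ∀ a > 0, 0 < rieszCoeff N κ a := fun a ha => by unfold rieszCoeff; positivity
    have hcont : ContinuousAt (fun a => rieszCoeff N κ a ^ (-(N : ℝ))) N := by
      refine ContinuousAt.rpow_const ?_ (Or.inl (hB0 N (by linarith)).ne')
      unfold rieszCoeff
      refine ContinuousAt.div_const (ContinuousAt.rpow_const ?_ (Or.inr hθ.le)) _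
      exact (continuousAt_const.div continuousAt_id (by simp only [id]; linarith)).mul_const _
    have hev : ∀ᶠ a in 𝓝[<] (N : ℝ), y < rieszCoeff N κ a ^ (-(N : ℝ)) :=
      (hcont.tendsto.mono_left nhdsWithin_le_nhds).eventually (lt_mem_nhds hy)
    obtain ⟨a, hya, ha⟩ := (hev.and (Ioo_mem_nhdsLT (by linarith : (0 : ℝ) < N))).exists
    obtain ⟨M, hM, hle⟩ := le_energyInf hN hH hr hΩo hΩb hΩne ha.1 ha.2
    have hlim : Tendsto (fun p : ℝ => (rieszRemainder N κ a * (p + 1) ^ (-(1 - (N : ℝ)⁻¹))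
        + rieszCoeff N κ a) ^ (-(N : ℝ)) * M ^ (-(N : ℝ) / (p + 1))) atTop
        (𝓝 ((rieszRemainder N κ a * 0 + rieszCoeff N κ a) ^ (-(N : ℝ)) * 1)) := by
      refine Tendsto.mul (Tendsto.rpow_const ?_ (Or.inl ?_)) ?_
      · refine ((Tendsto.const_mul _ ?_).add_const _)
        exact (tendsto_rpow_neg_atTop hθ).comp (tendsto_atTop_add_const_right _ _ tendsto_id)
      · rw [mul_zero, zero_add]
        exact (hB0 a ha.1).ne'
      · simpa only [neg_div] using tendsto_rpow_neg_const_div hM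
    rw [mul_zero, zero_add, mul_one] at hlim
    filter_upwards [hlim.eventually (lt_mem_nhds hya), eventually_gt_atTop 1] with p h1 hp
    exact h1.trans_le (hle p hp)
  · intro y hy
    obtain ⟨K, hK, hle⟩ := energyInf_le hN hH hr hΩo hΩne
    have hlim := (tendsto_rpow_neg_const_div (N := N) hK).const_mul (limitEnergy N (wulffVol N H))
    rw [mul_one] at hlim
    filter_upwards [hlim.eventually (gt_mem_nhds hy), eventually_gt_atTop 1] with p h1 hp
    exact (hle p hp).trans_lt h1

lemma energyInf_pos {N : ℕ} (hN : 2 ≤ N) {H : Euc N → ℝ} (hH : IsFinslerNorm N H)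
    (hr : FinslerRegular N H) {Ω : Set (Euc N)} (hΩo : IsOpen Ω) (hΩb : Bornology.IsBounded Ω)
    (hΩne : Ω.Nonempty) {p : ℝ} (hp : 1 < p) : 0 < energyInf N H Ω p := by
  have := nontrivial_euc hN
  have hκ : 0 < wulffVol N H := hH.dual.unitVol_pos
  have hN1 := one_lt_natCast hN
  have hN0 : (0 : ℝ) < N - 1 := by linarith
  have hθ := one_sub_inv_pos hN
  obtain ⟨M, hM, hle⟩ := le_energyInf hN hH hr hΩo hΩb hΩne one_pos hN1
  have hc0 : 0 < rieszRemainder N (wulffVol N H) 1 := by unfold rieszRemainder; positivity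
  have hB0 : 0 < rieszCoeff N (wulffVol N H) 1 := by unfold rieszCoeff; positivity
  have hq : 0 < p + 1 := by linarith
  refine pos_of_mul_pos_right (lt_of_lt_of_le ?_ (hle p hp)) (by positivity)
  positivity

lemma tendsto_pow_mul_energyInf {N : ℕ} (hN : 2 ≤ N) {H : Euc N → ℝ}
    (hH : IsFinslerNorm N H) (hr : FinslerRegular N H) {Ω : Set (Euc N)} (hΩo : IsOpen Ω)
    (hΩb : Bornology.IsBounded Ω) (hΩne : Ω.Nonempty) :
    Tendsto (fun p : ℝ => p ^ (N - 1) * energyInf N H Ω p) atTop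
      (𝓝 (limitEnergy N (wulffVol N H))) := by
  have h1 : Tendsto (fun p : ℝ => (p / (p + 1)) ^ (N - 1)) atTop (𝓝 (1 ^ (N - 1))) := by
    refine Tendsto.pow ?_ _
    have h2 : Tendsto (fun p : ℝ => 1 - 1 / (p + 1)) atTop (𝓝 (1 - 0)) :=
      tendsto_const_nhds.sub
        (tendsto_const_nhds.div_atTop (tendsto_atTop_add_const_right _ _ tendsto_id))
    rw [sub_zero] at h2
    refine h2.congr' ?_
    filter_upwards [eventually_gt_atTop 0] with p hp
    field_simp
    ring
  have h3 := h1.mul (tendsto_succ_pow_mul_energyInf hN hH hr hΩo hΩb hΩne)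
  rw [one_pow, one_mul] at h3
  refine h3.congr' ?_
  filter_upwards [eventually_gt_atTop 0] with p hp
  rw [div_pow]
  field_simp

/-! ### Testing the equation with `C¹` functions -/

lemma gradient_sub_norm {N : ℕ} (f g : Euc N → ℝ) (x : Euc N) :
    ‖gradient f x - gradient g x‖ = ‖fderiv ℝ f x - fderiv ℝ g x‖ := by
  simp only [gradient]
  rw [← map_sub, LinearIsometryEquiv.norm_map]

lemma exists_smooth_approx {N : ℕ} {Ω : Set (Euc N)} (hΩo : IsOpen Ω) {φ : Euc N → ℝ}
    (hφ : ContDiff ℝ 1 φ) (hc : HasCompactSupport φ) (hs : tsupport φ ⊆ Ω) :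
    ∃ K : Set (Euc N), IsCompact K ∧ K ⊆ Ω ∧ tsupport φ ⊆ K ∧ ∀ ε > 0, ∃ ψ : Euc N → ℝ,
      ContDiff ℝ (⊤ : ℕ∞) ψ ∧ HasCompactSupport ψ ∧ tsupport ψ ⊆ K ∧
      ∀ x, |ψ x - φ x| ≤ ε ∧ ‖gradient ψ x - gradient φ x‖ ≤ ε := by
  obtain ⟨ρ, hρ, hρΩ⟩ := hc.isCompact.exists_cthickening_subset_open hΩo hs
  refine ⟨Metric.cthickening ρ (tsupport φ), hc.isCompact.cthickening, hρΩ,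
    Metric.self_subset_cthickening _, fun ε hε => ?_⟩
  have hφc := hφ.continuous
  have hdc : Continuous (fderiv ℝ φ) := hφ.continuous_fderiv (by norm_num)
  have hu1 := hc.uniformContinuous_of_continuous hφc
  have hu2 := (hc.fderiv ℝ).uniformContinuous_of_continuous hdc
  obtain ⟨δ₁, hδ₁, h1⟩ := Metric.uniformContinuous_iff.1 hu1 ε hε
  obtain ⟨δ₂, hδ₂, h2⟩ := Metric.uniformContinuous_iff.1 hu2 ε hε
  set r := min ρ (min δ₁ δ₂) with hr
  have hr0 : 0 < r := lt_min hρ (lt_min hδ₁ hδ₂)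
  let η : ContDiffBump (0 : Euc N) := ⟨r / 2, r, by positivity, by linarith⟩
  set ψ := convolution (η.normed volume) φ (ContinuousLinearMap.lsmul ℝ ℝ) volume with hψ
  have hball : ∀ x : Euc N, ∀ y ∈ Metric.ball x η.rOut,
      dist y x < ρ ∧ dist y x < δ₁ ∧ dist y x < δ₂ := by
    intro x y hy
    have h : dist y x < r := hy
    exact ⟨h.trans_le (min_le_left _ _), h.trans_le ((min_le_right _ _).trans (min_le_left _ _)),
      h.trans_le ((min_le_right _ _).trans (min_le_right _ _))⟩
  have hloc : LocallyIntegrable (η.normed volume) volume :=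
    η.continuous_normed.locallyIntegrable
  have hzero : ∀ x, x ∉ Metric.cthickening ρ (tsupport φ) → ψ x = 0 := fun x hx => by
    have h0 : ∀ y ∈ Metric.ball x η.rOut, φ y = 0 := fun y hy => by
      by_contra hne
      refine hx (Metric.mem_cthickening_of_dist_le x y ρ _ (subset_tsupport _ hne) ?_)
      rw [dist_comm]
      exact (hball x y hy).1.le
    rw [hψ, η.normed_convolution_eq_right fun y hy => (h0 y hy).trans
      (h0 x (Metric.mem_ball_self η.rOut_pos)).symm]
    exact h0 x (Metric.mem_ball_self η.rOut_pos)
  have hsub : tsupport ψ ⊆ Metric.cthickening ρ (tsupport φ) :=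
    closure_minimal (fun x hx => by_contra fun h => hx (hzero x h)) Metric.isClosed_cthickening
  refine ⟨ψ, HasCompactSupport.contDiff_convolution_left _ η.hasCompactSupport_normed
    η.contDiff_normed hφc.locallyIntegrable,
    hc.isCompact.cthickening.of_isClosed_subset (isClosed_tsupport _) hsub, hsub,
    fun x => ⟨?_, ?_⟩⟩
  · rw [← Real.dist_eq]
    exact η.dist_normed_convolution_le hφc.aestronglyMeasurable
      fun y hy => (h1 (hball x y hy).2.1).le
  · have hd := hc.hasFDerivAt_convolution_right (ContinuousLinearMap.lsmul ℝ ℝ) hloc hφ x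
    have hL : (ContinuousLinearMap.lsmul ℝ ℝ : ℝ →L[ℝ] ℝ →L[ℝ] ℝ).precompR (Euc N)
        = ContinuousLinearMap.lsmul ℝ ℝ := by
      ext
      simp
    rw [gradient_sub_norm, hd.fderiv, hL, ← dist_eq_norm]
    exact η.dist_normed_convolution_le hdc.aestronglyMeasurable
      fun y hy => (h2 (hball x y hy).2.2).le

lemma measurable_gradient {N : ℕ} (u : Euc N → ℝ) : Measurable (gradient u) := by
  unfold gradient
  exact (LinearIsometryEquiv.continuous _).measurable.comp (measurable_fderiv ℝ u)

lemma exists_flux_bound {N : ℕ} (hN : 2 ≤ N) {H : Euc N → ℝ} (hH : IsFinslerNorm N H)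
    (hr : FinslerRegular N H) :
    ∃ C, 0 < C ∧ ∀ ξ v, |H ξ ^ (N - 1) * ⟪gradient H ξ, v⟫| ≤ C * H ξ ^ (N - 1) * ‖v‖ := by
  obtain ⟨C, hC, hle⟩ := hH.exists_le_norm
  refine ⟨C, hC, fun ξ v => ?_⟩
  rcases eq_or_ne ξ 0 with rfl | hξ
  · simp [hH.map_zero, show N - 1 ≠ 0 by omega]
  · rw [abs_mul, abs_of_nonneg (pow_nonneg (hH.nonneg _) _), mul_comm C, mul_assoc]
    refine mul_le_mul_of_nonneg_left ?_ (pow_nonneg (hH.nonneg _) _)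
    rw [abs_le]
    constructor
    · have := (hH.inner_gradient_le hr hξ (-v)).trans (hle _)
      rw [inner_neg_right, norm_neg] at this
      linarith
    · exact (hH.inner_gradient_le hr hξ v).trans (hle _)

lemma integrable_of_bounded_of_support {N : ℕ} {Ω K : Set (Euc N)} (hK : IsCompact K)
    {f : Euc N → ℝ} (hf : Measurable f) {B : ℝ} (hB : ∀ x ∈ K, |f x| ≤ B)
    (h0 : ∀ x, x ∉ K → f x = 0) : IntegrableOn f Ω := by
  have h1 : IntegrableOn f K := by
    refine Measure.integrableOn_of_bounded (M := B) hK.measure_lt_top.ne hf.aestronglyMeasurable ?_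
    filter_upwards [ae_restrict_mem hK.measurableSet] with x hx
    exact hB x hx
  exact ((integrableOn_iff_integrable_of_support_subset
    fun x hx => by_contra fun h => hx (h0 x h)).1 h1).integrableOn

lemma abs_setIntegral_le_of_support {N : ℕ} {Ω K : Set (Euc N)} (hK : IsCompact K)
    (hΩ : MeasurableSet Ω) (hKΩ : K ⊆ Ω) {f : Euc N → ℝ} {B : ℝ} (hB : ∀ x ∈ K, |f x| ≤ B)
    (h0 : ∀ x, x ∉ K → f x = 0) : |∫ x in Ω, f x| ≤ B * volume.real K := by
  rw [setIntegral_eq_of_subset_of_forall_sdiff_eq_zero hΩ hKΩ fun x hx => h0 x hx.2,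
    ← Real.norm_eq_abs]
  exact norm_setIntegral_le_of_norm_le_const hK.measure_lt_top hB

lemma IsWeakSolution.test_contDiff_one {N : ℕ} (hN : 2 ≤ N) {H : Euc N → ℝ}
    (hH : IsFinslerNorm N H) (hr : FinslerRegular N H) {Ω : Set (Euc N)} (hΩo : IsOpen Ω)
    {u g : Euc N → ℝ} (hu : ContDiffOn ℝ 1 u Ω) (hg : ContinuousOn g Ω)
    (hw : IsWeakSolution N H Ω u g)
    {φ : Euc N → ℝ} (hφ : ContDiff ℝ 1 φ) (hc : HasCompactSupport φ) (hs : tsupport φ ⊆ Ω) :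
    (∫ x in Ω, H (gradient u x) ^ (N - 1) * ⟪gradient H (gradient u x), gradient φ x⟫)
      = ∫ x in Ω, g x * φ x := by
  obtain ⟨K, hK, hKΩ, hφK, happ⟩ := exists_smooth_approx hΩo hφ hc hs
  obtain ⟨C, hC, hflux⟩ := exists_flux_bound hN hH hr
  have hgradu : ContinuousOn (gradient u) Ω :=
    (LinearIsometryEquiv.continuous _).comp_continuousOn
      (hu.continuousOn_fderiv_of_isOpen hΩo le_rfl)
  have hHu : ContinuousOn (fun x => H (gradient u x) ^ (N - 1)) K :=
    ((hH.continuous.comp_continuousOn hgradu).pow _).mono hKΩ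
  obtain ⟨B, hB⟩ := hK.exists_bound_of_continuousOn hHu
  obtain ⟨G, hG⟩ := hK.exists_bound_of_continuousOn (hg.mono hKΩ)
  have hB' : ∀ x ∈ K, ∀ v, |H (gradient u x) ^ (N - 1) * ⟪gradient H (gradient u x), v⟫|
      ≤ C * max B 0 * ‖v‖ := fun x hx v => by
    refine (hflux _ v).trans ?_
    have : H (gradient u x) ^ (N - 1) ≤ max B 0 :=
      ((le_abs_self _).trans (hB x hx)).trans (le_max_left _ _)
    gcongr
  have hfi : ∀ v : Euc N → ℝ, ContDiff ℝ 1 v → tsupport v ⊆ K → IntegrableOn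
      (fun x => H (gradient u x) ^ (N - 1) * ⟪gradient H (gradient u x), gradient v x⟫) Ω := by
    intro v hv hvK
    obtain ⟨D, hD⟩ := hK.exists_bound_of_continuousOn (continuous_gradient hv).continuousOn
    refine integrable_of_bounded_of_support hK (B := C * max B 0 * D) ?_ (fun x hx => ?_)
      fun x hx => ?_
    · exact ((hH.continuous.measurable.comp (measurable_gradient u)).pow_const _).mul
        (((measurable_gradient H).comp (measurable_gradient u)).inner (measurable_gradient v))
    · refine (hB' x hx _).trans ?_
      have := hD x hx
      gcongr
    · rw [gradient_eq_zero_of_notMem_tsupport fun h => hx (hvK h), inner_zero_right, mul_zero]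
  have hgi : ∀ v : Euc N → ℝ, Continuous v → tsupport v ⊆ K →
      IntegrableOn (fun x => g x * v x) Ω := by
    intro v hv hvK
    have h1 : IntegrableOn (fun x => g x * v x) K :=
      ((hg.mono hKΩ).mul hv.continuousOn).integrableOn_compact hK
    refine ((integrableOn_iff_integrable_of_support_subset fun x hx => ?_).1 h1).integrableOn
    exact hvK (subset_tsupport _ (right_ne_zero_of_mul hx))
  rw [← sub_eq_zero, ← abs_nonpos_iff]
  set M := (C * max B 0 + max G 0) * volume.real K with hM
  have hM0 : 0 ≤ M := by positivity
  have key : ∀ ε > 0, |(∫ x in Ω, H (gradient u x) ^ (N - 1) *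
      ⟪gradient H (gradient u x), gradient φ x⟫) - ∫ x in Ω, g x * φ x| ≤ M * ε := by
    intro ε hε
    obtain ⟨ψ, hψ, hψc, hψK, hψφ⟩ := happ ε hε
    have hψ1 : ContDiff ℝ 1 ψ := hψ.of_le (by exact_mod_cast le_top)
    have e := hw ψ hψ hψc (hψK.trans hKΩ)
    have e1 := integral_sub (hfi ψ hψ1 hψK) (hfi φ hφ hφK)
    have e2 := integral_sub (hgi ψ hψ1.continuous hψK) (hgi φ hφ.continuous hφK)
    have b1 := abs_setIntegral_le_of_support hK hΩo.measurableSet hKΩ (B := C * max B 0 * ε)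
      (f := fun x => H (gradient u x) ^ (N - 1) * ⟪gradient H (gradient u x), gradient ψ x⟫ -
        H (gradient u x) ^ (N - 1) * ⟪gradient H (gradient u x), gradient φ x⟫)
      (fun x hx => by
        rw [← mul_sub, ← inner_sub_right]
        refine (hB' x hx _).trans ?_
        have := (hψφ x).2
        gcongr)
      (fun x hx => by
        rw [gradient_eq_zero_of_notMem_tsupport fun h => hx (hψK h),
          gradient_eq_zero_of_notMem_tsupport fun h => hx (hφK h), sub_self])
    have b2 := abs_setIntegral_le_of_support hK hΩo.measurableSet hKΩ (B := max G 0 * ε)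
      (f := fun x => g x * ψ x - g x * φ x)
      (fun x hx => by
        rw [← mul_sub, abs_mul]
        have h1 := (hψφ x).1
        have h2 : |g x| ≤ max G 0 := (hG x hx).trans (le_max_left _ _)
        gcongr)
      (fun x hx => by
        rw [image_eq_zero_of_notMem_tsupport fun h => hx (hψK h),
          image_eq_zero_of_notMem_tsupport fun h => hx (hφK h), sub_self])
    rw [e1] at b1
    rw [e2] at b2
    have hMe : M * ε = C * max B 0 * ε * volume.real K + max G 0 * ε * volume.real K := by
      rw [hM]
      ring
    rw [abs_le] at b1 b2 ⊢
    constructor <;> linarith [b1.1, b1.2, b2.1, b2.2]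
  refine le_of_forall_pos_le_add fun ε hε => ?_
  refine (key (ε / (M + 1)) (by positivity)).trans ?_
  rw [zero_add, mul_div_assoc', div_le_iff₀ (by positivity)]
  nlinarith

/-! ### The energy identity -/

lemma exists_truncation : ∃ G : ℝ → ℝ, ∃ M : ℝ, ContDiff ℝ 1 G ∧ (∀ s ≤ 1, G s = 0) ∧
    (∀ s ≥ 2, G s = s) ∧ (∀ s ≥ 0, 0 ≤ G s ∧ G s ≤ s) ∧ (∀ s, |deriv G s| ≤ M) ∧
    ∀ s > 2, deriv G s = 1 := by
  have hG : ContDiff ℝ 1 fun s : ℝ => s * Real.smoothTransition (s - 1) :=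
    contDiff_id.mul (Real.smoothTransition.contDiff.comp (contDiff_id.sub contDiff_const))
  have h1 : ∀ s ≤ (1 : ℝ), s * Real.smoothTransition (s - 1) = 0 := fun s hs => by
    rw [Real.smoothTransition.zero_of_nonpos (by linarith), mul_zero]
  have h2 : ∀ s ≥ (2 : ℝ), s * Real.smoothTransition (s - 1) = s := fun s hs => by
    rw [Real.smoothTransition.one_of_one_le (by linarith), mul_one]
  have hd2 : ∀ s > (2 : ℝ), deriv (fun s : ℝ => s * Real.smoothTransition (s - 1)) s = 1 := by
    intro s hs
    have he : (fun s : ℝ => s * Real.smoothTransition (s - 1)) =ᶠ[𝓝 s] id := by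
      filter_upwards [lt_mem_nhds hs] with t ht using h2 t ht.le
    rw [he.deriv_eq, deriv_id]
  have hd1 : ∀ s < (1 : ℝ), deriv (fun s : ℝ => s * Real.smoothTransition (s - 1)) s = 0 := by
    intro s hs
    have he : (fun s : ℝ => s * Real.smoothTransition (s - 1)) =ᶠ[𝓝 s] fun _ => 0 := by
      filter_upwards [gt_mem_nhds hs] with t ht using h1 t ht.le
    rw [he.deriv_eq, deriv_const]
  obtain ⟨M, hM⟩ := (isCompact_Icc (a := (1 : ℝ)) (b := 2)).exists_bound_of_continuousOn
    (hG.continuous_deriv le_rfl).continuousOn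
  refine ⟨_, max M 1, hG, h1, h2, fun s hs => ⟨mul_nonneg hs (Real.smoothTransition.nonneg _),
    mul_le_of_le_one_right hs (Real.smoothTransition.le_one _)⟩, fun s => ?_, hd2⟩
  rcases lt_or_ge s 1 with h | h
  · rw [hd1 s h, abs_zero]
    exact zero_le_one.trans (le_max_right _ _)
  rcases lt_or_ge 2 s with h' | h'
  · rw [hd2 s h', abs_one]
    exact le_max_right _ _
  · exact (hM s ⟨h, h'⟩).trans (le_max_left _ _)

lemma IsWeakSolution.test_comp {N : ℕ} (hN : 2 ≤ N) {H : Euc N → ℝ}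
    (hH : IsFinslerNorm N H) (hr : FinslerRegular N H) {Ω : Set (Euc N)} (hΩo : IsOpen Ω)
    (hΩb : Bornology.IsBounded Ω) {u g : Euc N → ℝ} (hu : ContDiffOn ℝ 1 u (closure Ω))
    (hu0 : ∀ x ∈ frontier Ω, u x = 0) (hg : ContinuousOn g Ω) (hw : IsWeakSolution N H Ω u g)
    {G : ℝ → ℝ} (hG : ContDiff ℝ 1 G) {ε : ℝ} (hε : 0 < ε) (hGε : ∀ s ≤ ε, G s = 0) :
    (∫ x in Ω, deriv G (u x) * H (gradient u x) ^ N) = ∫ x in Ω, g x * G (u x) := by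
  classical
  have huΩ : ContDiffOn ℝ 1 u Ω := hu.mono subset_closure
  have huat : ∀ x ∈ Ω, ContDiffAt ℝ 1 u x := fun x hx => huΩ.contDiffAt (hΩo.mem_nhds hx)
  set K : Set (Euc N) := closure Ω ∩ u ⁻¹' Ici ε with hKdef
  have hKc : IsClosed K :=
    hu.continuousOn.preimage_isClosed_of_isClosed isClosed_closure isClosed_Ici
  have hK : IsCompact K :=
    hΩb.isCompact_closure.of_isClosed_subset hKc inter_subset_left
  have hKΩ : K ⊆ Ω := fun x hx => by
    by_contra h
    have h0 := hu0 x ⟨hx.1, by rwa [hΩo.interior_eq]⟩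
    have h1 : ε ≤ u x := hx.2
    linarith
  set φ : Euc N → ℝ := Ω.indicator (G ∘ u) with hφdef
  have hφK : ∀ x, x ∉ K → φ x = 0 := fun x hx => by
    by_cases hxΩ : x ∈ Ω
    · rw [hφdef, indicator_of_mem hxΩ]
      exact hGε _ (not_le.1 fun h => hx ⟨subset_closure hxΩ, h⟩).le
    · exact indicator_of_notMem hxΩ _
  have hts : tsupport φ ⊆ K :=
    closure_minimal (fun x hx => by_contra fun h => hx (hφK x h)) hKc
  have hloc : ∀ x ∈ Ω, φ =ᶠ[𝓝 x] G ∘ u := fun x hx => by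
    filter_upwards [hΩo.mem_nhds hx] with y hy using indicator_of_mem hy _
  have hφ : ContDiff ℝ 1 φ := contDiff_iff_contDiffAt.2 fun x => by
    by_cases hx : x ∈ Ω
    · exact (hG.contDiffAt.comp x (huat x hx)).congr_of_eventuallyEq (hloc x hx)
    · have h0 : φ =ᶠ[𝓝 x] fun _ => 0 := by
        filter_upwards [hKc.isOpen_compl.mem_nhds fun h => hx (hKΩ h)] with y hy using hφK y hy
      exact contDiffAt_const.congr_of_eventuallyEq h0
  have hgrad : ∀ x ∈ Ω, gradient φ x = deriv G (u x) • gradient u x := fun x hx => by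
    have h1 : HasDerivAt G (deriv G (u x)) (u x) :=
      (hG.differentiable (by norm_num) _).hasDerivAt
    have h2 := ((huat x hx).differentiableAt (by norm_num)).hasFDerivAt
    have h3 := (h1.comp_hasFDerivAt x h2).congr_of_eventuallyEq (hloc x hx)
    rw [gradient, gradient, h3.fderiv, map_smul]
  have h := hw.test_contDiff_one hN hH hr hΩo huΩ hg hφ
    (hK.of_isClosed_subset (isClosed_tsupport _) hts) (hts.trans hKΩ)
  have e1 : (∫ x in Ω, H (gradient u x) ^ (N - 1) *
      ⟪gradient H (gradient u x), gradient φ x⟫) =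
      ∫ x in Ω, deriv G (u x) * H (gradient u x) ^ N := by
    refine setIntegral_congr_fun hΩo.measurableSet fun x hx => ?_
    simp only [hgrad x hx, inner_smul_right]
    rcases eq_or_ne (gradient u x) 0 with h0 | h0
    · rw [h0, inner_zero_right, hH.map_zero, zero_pow (by omega : N ≠ 0)]
      ring
    · rw [hH.inner_gradient_self hr h0, ← mul_pow_sub_one (by omega : N ≠ 0) (H (gradient u x))]
      ring
  rw [← e1, h]
  refine setIntegral_congr_fun hΩo.measurableSet fun x hx => ?_
  simp only [hφdef, indicator_of_mem hx, Function.comp]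

lemma energy_identity {N : ℕ} (hN : 2 ≤ N) {H : Euc N → ℝ}
    (hH : IsFinslerNorm N H) (hr : FinslerRegular N H) {Ω : Set (Euc N)} (hΩo : IsOpen Ω)
    (hΩb : Bornology.IsBounded Ω) {u : Euc N → ℝ} (hu : ContDiffOn ℝ 1 u (closure Ω))
    (hpos : ∀ x ∈ Ω, 0 < u x) (hu0 : ∀ x ∈ frontier Ω, u x = 0) {p : ℝ} (hp : 0 < p)
    (hw : IsWeakSolution N H Ω u fun x => u x ^ p)
    (hint : IntegrableOn (fun x => H (gradient u x) ^ N) Ω)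
    (hint' : IntegrableOn (fun x => u x ^ (p + 1)) Ω) :
    (∫ x in Ω, H (gradient u x) ^ N) = ∫ x in Ω, u x ^ (p + 1) := by
  obtain ⟨G, M, hG, hG1, hG2, hGb, hGM, hGd⟩ := exists_truncation
  have huc : ContinuousOn u Ω := hu.continuousOn.mono subset_closure
  have hg : ContinuousOn (fun x => u x ^ p) Ω := huc.rpow_const fun x _ => Or.inr hp.le
  let ε : ℕ → ℝ := fun n => 1 / (n + 1)
  have hε : ∀ n, 0 < ε n := fun n => by positivity
  have hε0 : Tendsto ε atTop (𝓝 0) := tendsto_one_div_add_atTop_nhds_zero_nat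
  have hd : ∀ n s, HasDerivAt (fun s => ε n * G (s / ε n)) (deriv G (s / ε n)) s := fun n s => by
    have h1 : HasDerivAt G (deriv G (s / ε n)) (s / ε n) :=
      (hG.differentiable (by norm_num) _).hasDerivAt
    have h2 := ((h1.comp s ((hasDerivAt_id s).div_const (ε n))).const_mul (ε n))
    rwa [mul_one_div, mul_div_cancel₀ _ (hε n).ne'] at h2
  have hid : ∀ n, (∫ x in Ω, deriv G (u x / ε n) * H (gradient u x) ^ N) =
      ∫ x in Ω, u x ^ p * (ε n * G (u x / ε n)) := fun n => by
    have h := hw.test_comp hN hH hr hΩo hΩb hu hu0 hg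
      (G := fun s => ε n * G (s / ε n)) (contDiff_const.mul (hG.comp (contDiff_id.div_const _)))
      (hε n) fun s hs => by rw [hG1 _ ((div_le_one (hε n)).2 hs), mul_zero]
    rw [← h]
    refine integral_congr_ae (.of_forall fun x => ?_)
    simp only [(hd n (u x)).deriv]
  have hev : ∀ x ∈ Ω, ∀ᶠ n in atTop, 2 < u x / ε n := fun x hx => by
    filter_upwards [hε0.eventually (gt_mem_nhds (half_pos (hpos x hx)))] with n hn
    rw [lt_div_iff₀ (hε n)]
    linarith
  have hum : AEMeasurable u (volume.restrict Ω) := huc.aemeasurable hΩo.measurableSet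
  have t1 : Tendsto (fun n => ∫ x in Ω, deriv G (u x / ε n) * H (gradient u x) ^ N) atTop
      (𝓝 (∫ x in Ω, H (gradient u x) ^ N)) := by
    refine tendsto_integral_of_dominated_convergence (fun x => M * H (gradient u x) ^ N)
      (fun n => ?_) (hint.const_mul M) (fun n => .of_forall fun x => ?_) ?_
    · exact ((hG.continuous_deriv le_rfl).measurable.comp_aemeasurable
        (hum.div_const _)).aestronglyMeasurable.mul hint.aestronglyMeasurable
    · rw [norm_mul, Real.norm_eq_abs, Real.norm_of_nonneg (pow_nonneg (hH.nonneg _) _)]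
      exact mul_le_mul_of_nonneg_right (hGM _) (pow_nonneg (hH.nonneg _) _)
    · filter_upwards [ae_restrict_mem hΩo.measurableSet] with x hx
      refine tendsto_const_nhds.congr' ?_
      filter_upwards [hev x hx] with n hn
      rw [hGd _ hn, one_mul]
  have t2 : Tendsto (fun n => ∫ x in Ω, u x ^ p * (ε n * G (u x / ε n))) atTop
      (𝓝 (∫ x in Ω, u x ^ (p + 1))) := by
    refine tendsto_integral_of_dominated_convergence (fun x => u x ^ (p + 1))
      (fun n => ?_) hint' (fun n => ?_) ?_
    · exact ((hum.pow_const p).mul ((hG.continuous.measurable.comp_aemeasurable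
        (hum.div_const _)).const_mul _)).aestronglyMeasurable
    · filter_upwards [ae_restrict_mem hΩo.measurableSet] with x hx
      have hux := hpos x hx
      have hb := hGb (u x / ε n) (div_pos hux (hε n)).le
      rw [Real.norm_of_nonneg (mul_nonneg (by positivity) (mul_nonneg (hε n).le hb.1)),
        rpow_add_one hux.ne']
      refine mul_le_mul_of_nonneg_left ?_ (by positivity)
      calc ε n * G (u x / ε n) ≤ ε n * (u x / ε n) := mul_le_mul_of_nonneg_left hb.2 (hε n).le
        _ = u x := mul_div_cancel₀ _ (hε n).ne'
    · filter_upwards [ae_restrict_mem hΩo.measurableSet] with x hx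
      refine tendsto_const_nhds.congr' ?_
      filter_upwards [hev x hx] with n hn
      rw [hG2 _ hn.le, mul_div_cancel₀ _ (hε n).ne', rpow_add_one (hpos x hx).ne']
  exact tendsto_nhds_unique (t1.congr hid) t2

lemma IsLeastEnergySolution.energy_eq {N : ℕ} (hN : 2 ≤ N) {H : Euc N → ℝ}
    (hH : IsFinslerNorm N H) (hr : FinslerRegular N H) {Ω : Set (Euc N)} (hΩo : IsOpen Ω)
    (hΩb : Bornology.IsBounded Ω) (hΩne : Ω.Nonempty) {p : ℝ} (hp : 1 < p) {u : Euc N → ℝ}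
    (hu : IsLeastEnergySolution N H Ω p u) :
    0 < (∫ x in Ω, u x ^ (p + 1)) ∧
      (∫ x in Ω, H (gradient u x) ^ N) = ∫ x in Ω, u x ^ (p + 1) := by
  obtain ⟨huC, hpos, hu0, hw, hmin⟩ := hu
  have hcont : ContinuousOn (fun x => u x ^ (p + 1)) (closure Ω) :=
    huC.continuousOn.rpow_const fun x _ => Or.inr (by linarith)
  have hint' : IntegrableOn (fun x => u x ^ (p + 1)) Ω :=
    (hcont.integrableOn_compact hΩb.isCompact_closure).mono_set subset_closure
  have hpos' : 0 < ∫ x in Ω, u x ^ (p + 1) := by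
    rw [setIntegral_pos_iff_support_of_nonneg_ae _ hint']
    · refine (hΩo.measure_pos volume hΩne).trans_le (measure_mono fun x hx => ⟨?_, hx⟩)
      exact (rpow_pos_of_pos (hpos x hx) _).ne'
    · filter_upwards [ae_restrict_mem hΩo.measurableSet] with x hx
      exact (rpow_pos_of_pos (hpos x hx) _).le
  have hint : IntegrableOn (fun x => H (gradient u x) ^ N) Ω := by
    by_contra h
    rw [integral_undef h] at hmin
    exact (mul_pos (energyInf_pos hN hH hr hΩo hΩb hΩne hp) (rpow_pos_of_pos hpos' _)).ne hmin
  exact ⟨hpos', energy_identity hN hH hr hΩo hΩb huC hpos hu0 (by linarith) hw hint hint'⟩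

/-! ### The limit -/

lemma eq_rpow_of_eq_mul_rpow {E c a : ℝ} (hE : 0 < E) (ha : a < 1)
    (h : E = c * E ^ a) : E = c * c ^ (a / (1 - a)) := by
  have h1 : E ^ (1 - a) = c := by
    rw [rpow_sub hE, rpow_one, div_eq_iff (by positivity)]
    exact h
  have h2 : (1 : ℝ) - a ≠ 0 := by linarith
  rw [← h1, ← rpow_mul hE.le, ← rpow_add hE]
  have : 1 - a + (1 - a) * (a / (1 - a)) = 1 := by
    field_simp
    ring
  rw [this, rpow_one]

lemma tendsto_rpow_vanishing_exponent {N : ℕ} {c : ℝ → ℝ} {X : ℝ} (hX : 0 < X)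
    (hc : Tendsto (fun p => p ^ (N - 1) * c p) atTop (𝓝 X)) :
    Tendsto (fun p => c p ^ ((N : ℝ) / (p + 1 - N))) atTop (𝓝 1) := by
  have ha : Tendsto (fun p : ℝ => (N : ℝ) / (p + 1 - N)) atTop (𝓝 0) := by
    refine tendsto_const_nhds.div_atTop ?_
    simp only [add_sub_assoc]
    exact tendsto_atTop_add_const_right _ _ tendsto_id
  have h1 := hc.rpow ha (Or.inl hX.ne')
  rw [rpow_zero] at h1
  have h2 : Tendsto (fun p : ℝ => (p ^ (N - 1)) ^ ((N : ℝ) / (p + 1 - N))) atTop (𝓝 1) := by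
    have hl := ((Real.tendsto_pow_log_div_mul_add_atTop 1 (1 - N) 1 one_ne_zero).const_mul
      (((N - 1 : ℕ) : ℝ) * N)).rexp
    rw [mul_zero, Real.exp_zero] at hl
    refine hl.congr' ?_
    filter_upwards [eventually_gt_atTop 0] with p hp
    rw [pow_one, ← rpow_natCast, ← rpow_mul hp.le, rpow_def_of_pos hp]
    congr 1
    ring
  have h3 := h1.div h2 one_ne_zero
  rw [div_one] at h3
  refine h3.congr' ?_
  filter_upwards [eventually_gt_atTop 0, hc.eventually (lt_mem_nhds hX)] with p hp hcp
  have hcp' : 0 < c p := pos_of_mul_pos_right hcp (by positivity)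
  have : 0 < (p ^ (N - 1)) ^ ((N : ℝ) / (p + 1 - N)) := by positivity
  simp only [Pi.div_apply]
  rw [mul_rpow (by positivity) hcp'.le, mul_div_cancel_left₀ _ this.ne']

/-- Asymptotic energy identity (Theorem 1.1, second part). -/
theorem energy_limit (N : ℕ) (hN : 2 ≤ N) (H : Euc N → ℝ)
    (hnorm : IsFinslerNorm N H) (hreg : FinslerRegular N H)
    (Ω : Set (Euc N)) (hΩo : IsOpen Ω) (hΩb : Bornology.IsBounded Ω) (hΩne : Ω.Nonempty)
    (u : ℝ → Euc N → ℝ) (hu : ∀ p > 1, IsLeastEnergySolution N H Ω p (u p)) :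
    Tendsto (fun p : ℝ => p ^ (N - 1) * ∫ x in Ω, H (gradient (u p) x) ^ N) atTop
      (𝓝 ((N * Real.exp 1 / ((N : ℝ) - 1) * betaN N H) ^ (N - 1))) ∧
    Tendsto (fun p : ℝ => p ^ (N - 1) * ∫ x in Ω, u p x ^ (p + 1)) atTop
      (𝓝 ((N * Real.exp 1 / ((N : ℝ) - 1) * betaN N H) ^ (N - 1))) := by
  have := nontrivial_euc hN
  have hκ : 0 < wulffVol N H := hnorm.dual.unitVol_pos
  have hlim := tendsto_pow_mul_energyInf hN hnorm hreg hΩo hΩb hΩne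
  have hlim' : Tendsto (fun p : ℝ => p ^ (N - 1) * ∫ x in Ω, u p x ^ (p + 1)) atTop
      (𝓝 (limitEnergy N (wulffVol N H))) := by
    have h := hlim.mul (tendsto_rpow_vanishing_exponent (limitEnergy_pos hN hκ) hlim)
    rw [mul_one] at h
    refine h.congr' ?_
    filter_upwards [eventually_gt_atTop 1, eventually_gt_atTop (N : ℝ)] with p hp hpN
    obtain ⟨hpos, heq⟩ := (hu p hp).energy_eq hN hnorm hreg hΩo hΩb hΩne hp
    have hmin := (hu p hp).2.2.2.2
    rw [heq] at hmin
    have ha : (N : ℝ) / (p + 1) < 1 := (div_lt_one (by linarith)).2 (by linarith)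
    have hexp : (N : ℝ) / (p + 1) / (1 - N / (p + 1)) = N / (p + 1 - N) := by
      have h1 : p + 1 ≠ 0 := by linarith
      rw [one_sub_div h1, div_div_div_cancel_right₀ h1]
    rw [eq_rpow_of_eq_mul_rpow hpos ha hmin, hexp,
      mul_assoc]
  rw [← limitEnergy_eq hN hκ]
  refine ⟨hlim'.congr' ?_, hlim'⟩
  filter_upwards [eventually_gt_atTop 1] with p hp
  rw [((hu p hp).energy_eq hN hnorm hreg hΩo hΩb hΩne hp).2]
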